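/- arXiv:1211.7195 — 2 statements merged into one kernel-verified Lean document; each statement's English description precedes it below -/
import Mathlib

section
/- Assume f₁ = f₂, and write F̲(w) = f₁(‖w₁‖²,‖w₂‖²). There exist δ₀ > 0 and C > 0, depending only on R and the fixed data θ, f₁, G, such that the following holds for every δ with |δ| ≤ δ₀ and every α ∈ 𝓗² with Θ_R α = α and ‖α₁‖² + ‖α₂‖² = 1. Let u be the solution of the nonlinear Landau–Zener system (parameter δ) whose incoming scattering state is α, i.e. ‖u₁(s) − e^{iδF₁(α)s}·e^{iφ(s,GG*)}α₁‖ + ‖u₂(s) − e^{iδF₂(α)s}·e^{−iφ(s,G*G)}α₂‖ → 0 as s → −∞, and let S_δ(α) = ω be its outgoing scattering state (defined by the analogous condition as s → +∞). Let u^lin be the solution of the linear system (δ = 0) with u^lin(0) = u(0), with incoming and outgoing scattering states α^lin and ω^lin, and set Λ⁻ = ∫_{−∞}^0 (F̲(u^lin(τ)) − F̲(α^lin)) dτ and Λ⁺ = ∫_0^{+∞} (F̲(u^lin(τ)) − F̲(ω^lin)) dτ. Finally let S^lin(α) be the outgoing scattering state of the linear solution whose incoming scattering state is α. Then |Λ⁺|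 + |Λ⁻| ≤ C and ‖S_δ(α) − S^lin(α) − iδ(Λ⁺ + Λ⁻)·S^lin(α)‖ ≤ C·δ². -/
open ContinuousLinearMap Complex Filter Topology
open scoped InnerProductSpace

noncomputable section

variable {H : Type*} [NormedAddCommGroup H] [InnerProductSpace ℂ H] [CompleteSpace H]

/-- Functional calculus `χ(A)` of a selfadjoint operator `A` for a complex-valued
function `χ : ℝ → ℂ` (defined via the real continuous functional calculus applied to
the real and imaginary parts of `χ`). -/
def fc (χ : ℝ → ℂ) (A : H →L[ℂ] H) : H →L[ℂ] H :=
  cfc (fun x : ℝ => (χ x).re) A + Complex.I • cfc (fun x : ℝ => (χ x).im) A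

/-- The commutation assumption: for every continuous `χ : ℝ → ℂ`,
`χ(GG*)G = Gχ(G*G)` and `χ(G*G)G* = G*χ(GG*)`. -/
def CommHyp (G : H →L[ℂ] H) : Prop :=
  ∀ χ : ℝ → ℂ, Continuous χ →
    (fc χ (G * ContinuousLinearMap.adjoint G)) ∘L G
        = G ∘L (fc χ (ContinuousLinearMap.adjoint G * G)) ∧
    (fc χ (ContinuousLinearMap.adjoint G * G)) ∘L ContinuousLinearMap.adjoint G
        = ContinuousLinearMap.adjoint G ∘L (fc χ (G * ContinuousLinearMap.adjoint G))

/-- The equivalence between `𝓗²` (with its Hilbert space structure) and `𝓗 × 𝓗`. -/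
def eqv : WithLp 2 (H × H) ≃L[ℂ] H × H := WithLp.prodContinuousLinearEquiv 2 ℂ H H

/-- The operator `V(s)(w₁,w₂) = (s·w₁ + Gw₂, G*w₁ − s·w₂)` on `𝓗²`. -/
def Vop (G : H →L[ℂ] H) (s : ℝ) : WithLp 2 (H × H) →L[ℂ] WithLp 2 (H × H) :=
  (eqv (H := H)).symm.toContinuousLinearMap ∘L
    ((((s : ℂ) • ContinuousLinearMap.fst ℂ H H + G ∘L ContinuousLinearMap.snd ℂ H H)).prod
      ((ContinuousLinearMap.adjoint G) ∘L ContinuousLinearMap.fst ℂ H H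
        - (s : ℂ) • ContinuousLinearMap.snd ℂ H H)) ∘L
    (eqv (H := H)).toContinuousLinearMap

/-- `F₁(u) = f₁(‖u₁‖², ‖u₂‖²)`. -/
def F1 (f₁ : ℝ × ℝ → ℝ) (u : WithLp 2 (H × H)) : ℝ := f₁ (‖u.fst‖ ^ 2, ‖u.snd‖ ^ 2)

/-- `F₂(u) = f₂(‖u₁‖², ‖u₂‖²)`. -/
def F2 (f₂ : ℝ × ℝ → ℝ) (u : WithLp 2 (H × H)) : ℝ := f₂ (‖u.fst‖ ^ 2, ‖u.snd‖ ^ 2)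

/-- The nonlinear term `F(u)u = (F₁(u)u₁, F₂(u)u₂)`. -/
def nlt (f₁ f₂ : ℝ × ℝ → ℝ) (u : WithLp 2 (H × H)) : WithLp 2 (H × H) :=
  (WithLp.equiv 2 (H × H)).symm ((F1 f₁ u) • u.fst, (F2 f₂ u) • u.snd)

/-- `u` is a (global, `C¹`) solution of `−i u′(s) = V(s)u(s) + δ F(u(s))u(s)`:
equivalently, `u′(s) = i (V(s)u(s) + δ F(u(s))u(s))` for all `s`. -/
def IsLZSol (G : H →L[ℂ] H) (δ : ℝ) (f₁ f₂ : ℝ × ℝ → ℝ) (u : ℝ → WithLp 2 (H × H)) : Prop :=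
  ∀ s : ℝ, HasDerivAt u (Complex.I • (Vop G s (u s) + δ • nlt f₁ f₂ (u s))) s

/-- `f ∈ C²(ℝ²;ℝ)` with bounded second derivative. -/
def C2Bdd (f : ℝ × ℝ → ℝ) : Prop :=
  ContDiff ℝ 2 f ∧ ∃ C : ℝ, ∀ p : ℝ × ℝ, ‖iteratedFDeriv ℝ 2 f p‖ ≤ C

/-- `θ ∈ C_c^∞(ℝ;ℝ)`, `0 ≤ θ ≤ 1`, `θ = 1` on `(−1/2,1/2)` and `θ = 0` outside `[−1,1]`. -/
def IsCutoff (θ : ℝ → ℝ) : Prop :=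
  ContDiff ℝ (⊤ : ℕ∞) θ ∧ HasCompactSupport θ ∧ (∀ x, 0 ≤ θ x ∧ θ x ≤ 1) ∧
    (∀ x, |x| < 1/2 → θ x = 1) ∧ (∀ x, 1 < |x| → θ x = 0)

/-- The cutoff operator `Θ_R = diag(θ(GG*/R²), θ(G*G/R²))`. -/
def Theta (G : H →L[ℂ] H) (θ : ℝ → ℝ) (R : ℝ) :
    WithLp 2 (H × H) →L[ℂ] WithLp 2 (H × H) :=
  (eqv (H := H)).symm.toContinuousLinearMap ∘L
    ((cfc (fun x : ℝ => θ (x / R ^ 2)) (G * ContinuousLinearMap.adjoint G)).prodMap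
      (cfc (fun x : ℝ => θ (x / R ^ 2)) (ContinuousLinearMap.adjoint G * G))) ∘L
    (eqv (H := H)).toContinuousLinearMap

/-- The phase `φ(s,λ) = s²/2 + (λ/2)·log|s|`. -/
def phase (s lam : ℝ) : ℝ := s ^ 2 / 2 + lam / 2 * Real.log |s|

/-- The unitary operator `e^{iφ(s,GG*)}` on `𝓗`. -/
def ePhaseP (G : H →L[ℂ] H) (s : ℝ) : H →L[ℂ] H :=
  fc (fun lam => Complex.exp (Complex.I * (phase s lam))) (G * ContinuousLinearMap.adjoint G)

/-- The unitary operator `e^{−iφ(s,G*G)}` on `𝓗`. -/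
def ePhaseM (G : H →L[ℂ] H) (s : ℝ) : H →L[ℂ] H :=
  fc (fun lam => Complex.exp (-(Complex.I * (phase s lam))))
    (ContinuousLinearMap.adjoint G * G)

/-- The model asymptotic first component `e^{iδF₁(ω)s + iϕ}·e^{iφ(s,GG*)}ω₁`. -/
def asym1 (G : H →L[ℂ] H) (δ : ℝ) (f₁ : ℝ × ℝ → ℝ) (ω : WithLp 2 (H × H)) (ϕ : ℝ)
    (s : ℝ) : H :=
  Complex.exp (Complex.I * (δ * F1 f₁ ω * s + ϕ)) • (ePhaseP G s ω.fst)

/-- The model asymptotic second component `e^{iδF₂(ω)s − iϕ}·e^{−iφ(s,G*G)}ω₂`. -/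
def asym2 (G : H →L[ℂ] H) (δ : ℝ) (f₂ : ℝ × ℝ → ℝ) (ω : WithLp 2 (H × H)) (ϕ : ℝ)
    (s : ℝ) : H :=
  Complex.exp (Complex.I * (δ * F2 f₂ ω * s - ϕ)) • (ePhaseM G s ω.snd)

/-- `α` is the incoming scattering state (at `s → −∞`) of `u`, with phase shift `ϕ`. -/
def Incoming (G : H →L[ℂ] H) (δ : ℝ) (f₁ f₂ : ℝ × ℝ → ℝ) (α : WithLp 2 (H × H)) (ϕ : ℝ)
    (u : ℝ → WithLp 2 (H × H)) : Prop :=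
  Tendsto (fun s => ‖(u s).fst - asym1 G δ f₁ α ϕ s‖ + ‖(u s).snd - asym2 G δ f₂ α ϕ s‖)
    atBot (𝓝 0)

/-- `ω` is the outgoing scattering state (at `s → +∞`) of `u`, with phase shift `ϕ`. -/
def Outgoing (G : H →L[ℂ] H) (δ : ℝ) (f₁ f₂ : ℝ × ℝ → ℝ) (ω : WithLp 2 (H × H)) (ϕ : ℝ)
    (u : ℝ → WithLp 2 (H × H)) : Prop :=
  Tendsto (fun s => ‖(u s).fst - asym1 G δ f₁ ω ϕ s‖ + ‖(u s).snd - asym2 G δ f₂ ω ϕ s‖)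
    atTop (𝓝 0)

/-- `M(u) = (δ/2)(F₁(u) + F₂(u))`. -/
def Mscal (δ : ℝ) (f₁ f₂ : ℝ × ℝ → ℝ) (u : WithLp 2 (H × H)) : ℝ :=
  δ / 2 * (F1 f₁ u + F2 f₂ u)

/-- `m(u) = (δ/2)(F₁(u) − F₂(u))`. -/
def mscal (δ : ℝ) (f₁ f₂ : ℝ × ℝ → ℝ) (u : WithLp 2 (H × H)) : ℝ :=
  δ / 2 * (F1 f₁ u - F2 f₂ u)

/-- The gauge transform `v(s) = e^{−i∫₀ˢ M(u(τ))dτ}·u(s)`. -/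
def gaugeT (δ : ℝ) (f₁ f₂ : ℝ × ℝ → ℝ) (u : ℝ → WithLp 2 (H × H)) :
    ℝ → WithLp 2 (H × H) :=
  fun s => Complex.exp (-(Complex.I * (∫ τ in (0:ℝ)..s, Mscal δ f₁ f₂ (u τ)))) • u s

/-- `σ(s) = s + m(u(s))`. -/
def sigma (δ : ℝ) (f₁ f₂ : ℝ × ℝ → ℝ) (u : ℝ → WithLp 2 (H × H)) (s : ℝ) : ℝ :=
  s + mscal δ f₁ f₂ (u s)

/-- The operator `Λ_t = diag((t² + GG*)^{1/2}, (t² + G*G)^{1/2})` on `𝓗²`. -/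
def LamOp (G : H →L[ℂ] H) (t : ℝ) : WithLp 2 (H × H) →L[ℂ] WithLp 2 (H × H) :=
  (eqv (H := H)).symm.toContinuousLinearMap ∘L
    ((cfc (fun x : ℝ => Real.sqrt (t ^ 2 + x)) (G * ContinuousLinearMap.adjoint G)).prodMap
      (cfc (fun x : ℝ => Real.sqrt (t ^ 2 + x)) (ContinuousLinearMap.adjoint G * G))) ∘L
    (eqv (H := H)).toContinuousLinearMap

/-- The operator `Λ_t⁻¹ = diag((t² + GG*)^{-1/2}, (t² + G*G)^{-1/2})` on `𝓗²`. -/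
def LamInv (G : H →L[ℂ] H) (t : ℝ) : WithLp 2 (H × H) →L[ℂ] WithLp 2 (H × H) :=
  (eqv (H := H)).symm.toContinuousLinearMap ∘L
    ((cfc (fun x : ℝ => (Real.sqrt (t ^ 2 + x))⁻¹)
        (G * ContinuousLinearMap.adjoint G)).prodMap
      (cfc (fun x : ℝ => (Real.sqrt (t ^ 2 + x))⁻¹)
        (ContinuousLinearMap.adjoint G * G))) ∘L
    (eqv (H := H)).toContinuousLinearMap

/-- The projection `Π_t^+ = (1/2)(Id + Λ_t⁻¹V(t))`. -/
def PiP (G : H →L[ℂ] H) (t : ℝ) : WithLp 2 (H × H) →L[ℂ] WithLp 2 (H × H) :=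
  (2 : ℂ)⁻¹ • (1 + LamInv G t ∘L Vop G t)

/-- The projection `Π_t^- = (1/2)(Id − Λ_t⁻¹V(t))`. -/
def PiM (G : H →L[ℂ] H) (t : ℝ) : WithLp 2 (H × H) →L[ℂ] WithLp 2 (H × H) :=
  (2 : ℂ)⁻¹ • (1 - LamInv G t ∘L Vop G t)

/-- `m̃(x,y) = (δ/2)(f₁(x,y) − f₂(x,y))`. -/
def mtilde (δ : ℝ) (f₁ f₂ : ℝ × ℝ → ℝ) : ℝ × ℝ → ℝ := fun p => δ / 2 * (f₁ p - f₂ p)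

/-- `m̲(s) = (∂₁m̃ − ∂₂m̃)(‖v₁(s)‖², ‖v₂(s)‖²)`. -/
def mbar (δ : ℝ) (f₁ f₂ : ℝ × ℝ → ℝ) (v : ℝ → WithLp 2 (H × H)) (s : ℝ) : ℝ :=
  fderiv ℝ (mtilde δ f₁ f₂) (‖(v s).fst‖ ^ 2, ‖(v s).snd‖ ^ 2) (1, 0) -
    fderiv ℝ (mtilde δ f₁ f₂) (‖(v s).fst‖ ^ 2, ‖(v s).snd‖ ^ 2) (0, 1)


/-- The operator `A(a,b,c,d)(w₁,w₂) = (a(GG*)w₁ + b(GG*)Gw₂, c(G*G)G*w₁ + d(G*G)w₂)`. -/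
def Aop (G : H →L[ℂ] H) (a b c d : ℝ → ℂ) :
    WithLp 2 (H × H) →L[ℂ] WithLp 2 (H × H) :=
  (eqv (H := H)).symm.toContinuousLinearMap ∘L
    (((fc a (G * ContinuousLinearMap.adjoint G)) ∘L ContinuousLinearMap.fst ℂ H H
        + (fc b (G * ContinuousLinearMap.adjoint G)) ∘L G ∘L ContinuousLinearMap.snd ℂ H H).prod
      ((fc c (ContinuousLinearMap.adjoint G * G)) ∘L (ContinuousLinearMap.adjoint G)
          ∘L ContinuousLinearMap.fst ℂ H H
        + (fc d (ContinuousLinearMap.adjoint G * G)) ∘L ContinuousLinearMap.snd ℂ H H)) ∘L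
    (eqv (H := H)).toContinuousLinearMap

/-- The operator `𝒦(w₁,w₂) = (−Gw₂, G*w₁)` on `𝓗²`. -/
def Kcal (G : H →L[ℂ] H) : WithLp 2 (H × H) →L[ℂ] WithLp 2 (H × H) :=
  (eqv (H := H)).symm.toContinuousLinearMap ∘L
    ((-(G ∘L ContinuousLinearMap.snd ℂ H H)).prod
      ((ContinuousLinearMap.adjoint G) ∘L ContinuousLinearMap.fst ℂ H H)) ∘L
    (eqv (H := H)).toContinuousLinearMap


theorem abs_sub_le_of_abs_deriv_le {Q Q' B B' : ℝ → ℝ}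
    (hQ : ∀ t, 1 ≤ t → HasDerivAt Q (Q' t) t) (hB : ∀ t, 1 ≤ t → HasDerivAt B (B' t) t)
    (h : ∀ t, 1 ≤ t → |Q' t| ≤ B' t) {s t : ℝ} (hs : 1 ≤ s) (hst : s ≤ t) :
    |Q t - Q s| ≤ B t - B s := by
  have key : ∀ R R' : ℝ → ℝ, (∀ t, 1 ≤ t → HasDerivAt R (R' t) t) →
      (∀ t, 1 ≤ t → 0 ≤ R' t) → R s ≤ R t := by
    intro R R' hR h0
    have hmono : MonotoneOn R (Set.Ici 1) := by
      apply monotoneOn_of_deriv_nonneg (convex_Ici 1)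
      · exact fun x hx => (hR x hx).continuousAt.continuousWithinAt
      · intro x hx
        rw [interior_Ici] at hx
        exact (hR x hx.le).differentiableAt.differentiableWithinAt
      · intro x hx
        rw [interior_Ici] at hx
        rw [(hR x hx.le).deriv]
        exact h0 x hx.le
    exact hmono hs (hs.trans hst) hst
  have h1 := key (fun t => B t - Q t) _ (fun t ht => (hB t ht).fun_sub (hQ t ht))
    (fun t ht => by linarith [(abs_le.1 (h t ht)).2])
  have h2 := key (fun t => B t + Q t) _ (fun t ht => (hB t ht).fun_add (hQ t ht))
    (fun t ht => by linarith [(abs_le.1 (h t ht)).1])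
  rw [abs_le]
  constructor <;> linarith

/-- Decay of the transition probability: up to the oscillating term `a/t`, the function `p`
approaches its limit at rate `t⁻²`. -/
theorem abs_sub_limit_add_div_le {p a b r : ℝ → ℝ} {A pinf : ℝ}
    (hp : ∀ t, HasDerivAt p (-2 * b t) t) (ha : ∀ t, HasDerivAt a (2 * t * b t) t)
    (hb : ∀ t, HasDerivAt b (-2 * t * a t + r t) t)
    (hA : ∀ t, |a t| ≤ A) (hbA : ∀ t, |b t| ≤ A) (hrA : ∀ t, |r t| ≤ A)
    (hlim : Tendsto p atTop (𝓝 pinf)) {t : ℝ} (ht : 1 ≤ t) :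
    |p t - pinf + a t / t| ≤ 2 * A / t ^ 2 := by
  have hA0 : 0 ≤ A := (abs_nonneg _).trans (hA 0)
  have hQ : ∀ t, 1 ≤ t → HasDerivAt (fun t => p t + a t / t - b t / (2 * t ^ 3))
      (-(r t) / (2 * t ^ 3) + 3 * b t / (2 * t ^ 4)) t := by
    intro t ht
    have ht0 : t ≠ 0 := by positivity
    have h3 : HasDerivAt (fun t : ℝ => 2 * t ^ 3) (2 * (3 * t ^ 2)) t := by
      simpa using (hasDerivAt_pow 3 t).const_mul 2
    refine (((hp t).fun_add ((ha t).fun_div (hasDerivAt_id' t) ht0)).fun_sub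
      ((hb t).fun_div h3 (by positivity))).congr_deriv ?_
    field_simp
    ring
  have hB : ∀ t : ℝ, 1 ≤ t → HasDerivAt (fun t : ℝ => -A / t ^ 2) (2 * A / t ^ 3) t := by
    intro t ht
    have ht0 : t ≠ 0 := by positivity
    refine ((hasDerivAt_const t (-A)).fun_div (hasDerivAt_pow 2 t) (by positivity)).congr_deriv ?_
    field_simp
    norm_num
    ring
  have hle : ∀ t, 1 ≤ t →
      |-(r t) / (2 * t ^ 3) + 3 * b t / (2 * t ^ 4)| ≤ 2 * A / t ^ 3 := by
    intro t ht
    have ht0 : 0 < t := by positivity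
    have hbt : |b t / t| ≤ A := by
      rw [abs_div, abs_of_pos ht0]
      exact (div_le_self (abs_nonneg _) ht).trans (hbA t)
    have : -(r t) / (2 * t ^ 3) + 3 * b t / (2 * t ^ 4)
        = ((-(r t) + 3 * (b t / t)) / 2) / t ^ 3 := by field_simp
    rw [this, abs_div, abs_of_pos (pow_pos ht0 3)]
    gcongr
    have h1 := abs_le.1 hbt
    have h2 := abs_le.1 (hrA t)
    rw [abs_le]; constructor <;> linarith
  have hinv : Tendsto (fun t : ℝ => t⁻¹) atTop (𝓝 0) := tendsto_inv_atTop_zero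
  have hbdd : ∀ z : ℝ → ℝ, (∀ t, |z t| ≤ A) → Tendsto (fun t => z t * t⁻¹) atTop (𝓝 0) := by
    intro z hz
    refine squeeze_zero_norm' (a := fun t => A * t⁻¹) ?_ (by simpa using hinv.const_mul A)
    filter_upwards [eventually_gt_atTop 0] with t ht
    rw [norm_mul, Real.norm_eq_abs, Real.norm_eq_abs, abs_of_pos (inv_pos.2 ht)]
    gcongr
    exact hz t
  have hQlim : Tendsto (fun t => p t + a t / t - b t / (2 * t ^ 3)) atTop (𝓝 pinf) := by
    have := (hlim.add (hbdd a hA)).sub (((hbdd b hbA).mul (hinv.pow 2)).div_const 2)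
    simp only [add_zero, mul_zero, ne_eq, OfNat.ofNat_ne_zero, not_false_eq_true,
      zero_pow, zero_div, sub_zero] at this
    refine this.congr' ?_
    filter_upwards [eventually_gt_atTop 0] with t ht
    field_simp
  have hBlim : Tendsto (fun t : ℝ => -A / t ^ 2) atTop (𝓝 0) := by
    have := (hinv.pow 2).const_mul (-A)
    simpa [div_eq_mul_inv] using this
  have hmain : |pinf - (p t + a t / t - b t / (2 * t ^ 3))| ≤ 0 - -A / t ^ 2 := by
    refine le_of_tendsto_of_tendsto (hQlim.sub_const _).abs (hBlim.sub_const _) ?_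
    filter_upwards [eventually_ge_atTop t] with s hs
    exact abs_sub_le_of_abs_deriv_le hQ hB hle ht hs
  have ht0 : 0 < t := by positivity
  have hb3 : |b t / (2 * t ^ 3)| ≤ A / t ^ 2 := by
    rw [abs_div, abs_of_pos (by positivity : (0:ℝ) < 2 * t ^ 3)]
    have : t ^ 2 ≤ 2 * t ^ 3 := by nlinarith [pow_pos ht0 2]
    gcongr
    exact hbA t
  have e1 : 2 * A / t ^ 2 = A / t ^ 2 + A / t ^ 2 := by ring
  have e2 : (0:ℝ) - -A / t ^ 2 = A / t ^ 2 := by ring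
  rw [e2] at hmain
  rw [e1]
  have h1 := abs_le.1 hmain
  have h2 := abs_le.1 hb3
  rw [abs_le]; constructor <;> linarith

theorem abs_integral_comp_sub_limit_le {p a b r g : ℝ → ℝ} {A M c pinf : ℝ}
    (hp : ∀ t, HasDerivAt p (-2 * b t) t) (ha : ∀ t, HasDerivAt a (2 * t * b t) t)
    (hb : ∀ t, HasDerivAt b (-2 * t * a t + r t) t)
    (hA : ∀ t, |a t| ≤ A) (hbA : ∀ t, |b t| ≤ A) (hrA : ∀ t, |r t| ≤ A)
    (hlim : Tendsto p atTop (𝓝 pinf)) (hp01 : ∀ t, p t ∈ Set.Icc (0 : ℝ) 1)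
    (hg : Continuous g) (hc : |c| ≤ M)
    (hgc : ∀ x ∈ Set.Icc (0 : ℝ) 1, |g x - g pinf - c * (x - pinf)| ≤ M * (x - pinf) ^ 2)
    {t : ℝ} (ht : 1 ≤ t) :
    |∫ τ in (0 : ℝ)..t, (g (p τ) - g pinf)| ≤ 2 * M + 5 * M * A + 9 * M * A ^ 2 := by
  have hA0 : 0 ≤ A := (abs_nonneg _).trans (hA 0)
  have hM0 : 0 ≤ M := (abs_nonneg _).trans hc
  have hpinf : pinf ∈ Set.Icc (0 : ℝ) 1 :=
    isClosed_Icc.mem_of_tendsto hlim (Eventually.of_forall hp01)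
  have hpc : Continuous p := continuous_iff_continuousAt.2 fun t => (hp t).continuousAt
  have hcont : Continuous fun τ => g (p τ) - g pinf := (hg.comp hpc).sub continuous_const
  have hI : ∀ t, HasDerivAt (fun t => ∫ τ in (0 : ℝ)..t, (g (p τ) - g pinf))
      (g (p t) - g pinf) t := fun t =>
    intervalIntegral.integral_hasDerivAt_right (hcont.intervalIntegrable _ _)
      (hcont.stronglyMeasurableAtFilter _ _) hcont.continuousAt
  have hI1 : |∫ τ in (0 : ℝ)..1, (g (p τ) - g pinf)| ≤ 2 * M := by
    have := intervalIntegral.norm_integral_le_of_norm_le_const (a := (0 : ℝ)) (b := 1)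
      (f := fun τ => g (p τ) - g pinf) (C := 2 * M) ?_
    · simpa using this
    intro τ _
    have h1 := abs_le.1 (hgc _ (hp01 τ))
    have h2 : |p τ - pinf| ≤ 1 := by
      rw [abs_le]
      constructor <;> linarith [(hp01 τ).1, (hp01 τ).2, hpinf.1, hpinf.2]
    have h3 : (p τ - pinf) ^ 2 ≤ 1 := (sq_le_one_iff_abs_le_one _).2 h2
    have h4 : |c * (p τ - pinf)| ≤ M * 1 := by
      rw [abs_mul]; gcongr
    have h5 := abs_le.1 h4
    have h6 : M * (p τ - pinf) ^ 2 ≤ M * 1 := by gcongr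
    rw [Real.norm_eq_abs, abs_le]
    constructor <;> linarith
  have hJ : ∀ t, 1 ≤ t → HasDerivAt
      (fun t => (∫ τ in (0 : ℝ)..t, (g (p τ) - g pinf)) - c * (b t / (2 * t ^ 2)))
      (g (p t) - g pinf + c * (a t / t) - c * r t / (2 * t ^ 2) + c * b t / t ^ 3) t := by
    intro t ht
    have ht0 : t ≠ 0 := by positivity
    have h3 : HasDerivAt (fun t : ℝ => 2 * t ^ 2) (2 * (2 * t)) t := by
      simpa using (hasDerivAt_pow 2 t).const_mul 2
    refine ((hI t).fun_sub (((hb t).fun_div h3 (by positivity)).const_mul c)).congr_deriv ?_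
    field_simp
    ring
  have hB : ∀ t : ℝ, 1 ≤ t → HasDerivAt (fun t : ℝ => -(4 * M * A + 9 * M * A ^ 2) / t)
      ((4 * M * A + 9 * M * A ^ 2) / t ^ 2) t := by
    intro t ht
    have ht0 : t ≠ 0 := by positivity
    refine ((hasDerivAt_const t (-(4 * M * A + 9 * M * A ^ 2))).fun_div
      (hasDerivAt_id' t) ht0).congr_deriv ?_
    simp
  have hle : ∀ t, 1 ≤ t →
      |g (p t) - g pinf + c * (a t / t) - c * r t / (2 * t ^ 2) + c * b t / t ^ 3|
        ≤ (4 * M * A + 9 * M * A ^ 2) / t ^ 2 := by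
    intro t ht
    have ht0 : 0 < t := by positivity
    have h1 := abs_sub_limit_add_div_le hp ha hb hA hbA hrA hlim ht
    have hdec : 2 * A / t ^ 2 ≤ 2 * A / t := by
      have : t ≤ t ^ 2 := by nlinarith
      gcongr
    have h2 : |p t - pinf| ≤ 3 * A / t := by
      have h3 : |a t / t| ≤ A / t := by
        rw [abs_div, abs_of_pos ht0]; gcongr; exact hA t
      have h4 := abs_le.1 h1
      have h5 := abs_le.1 h3
      have e : 3 * A / t = 2 * A / t + A / t := by ring
      rw [e, abs_le]; constructor <;> linarith
    have h3 : (p t - pinf) ^ 2 ≤ 9 * A ^ 2 / t ^ 2 := by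
      have := pow_le_pow_left₀ (abs_nonneg _) h2 2
      rw [sq_abs] at this
      refine this.trans (le_of_eq (by ring))
    have h4 : |g (p t) - g pinf - c * (p t - pinf)| ≤ M * (9 * A ^ 2 / t ^ 2) :=
      (hgc _ (hp01 t)).trans (by gcongr)
    have h5 : |c * (p t - pinf + a t / t)| ≤ M * (2 * A / t ^ 2) := by
      rw [abs_mul]; gcongr
    have h6 : |c * r t / (2 * t ^ 2)| ≤ M * A / t ^ 2 := by
      rw [abs_div, abs_mul, abs_of_pos (by positivity : (0:ℝ) < 2 * t ^ 2)]
      gcongr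
      · exact hrA t
      · nlinarith [pow_pos ht0 2]
    have h7 : |c * b t / t ^ 3| ≤ M * A / t ^ 2 := by
      rw [abs_div, abs_mul, abs_of_pos (by positivity : (0:ℝ) < t ^ 3)]
      gcongr
      · exact hbA t
      · norm_num
    have e : (4 * M * A + 9 * M * A ^ 2) / t ^ 2 = M * (9 * A ^ 2 / t ^ 2) + M * (2 * A / t ^ 2)
        + M * A / t ^ 2 + M * A / t ^ 2 := by ring
    have k4 := abs_le.1 h4
    have k5 := abs_le.1 h5
    have k6 := abs_le.1 h6
    have k7 := abs_le.1 h7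
    rw [e, abs_le]
    constructor <;> linarith
  have hmain := abs_sub_le_of_abs_deriv_le hJ hB hle le_rfl ht
  have hcb : ∀ s, 1 ≤ s → |c * (b s / (2 * s ^ 2))| ≤ M * A / 2 := by
    intro s hs
    rw [abs_mul, abs_div, abs_of_pos (by positivity : (0:ℝ) < 2 * s ^ 2), mul_div_assoc]
    have : (2:ℝ) ≤ 2 * s ^ 2 := by nlinarith
    gcongr
    exact hbA s
  have k1 := abs_le.1 (hcb 1 le_rfl)
  have k2 := abs_le.1 (hcb t ht)
  have k3 := abs_le.1 hI1
  have k4 := abs_le.1 hmain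
  have k5 : 0 ≤ (4 * M * A + 9 * M * A ^ 2) / t := by positivity
  have e1 : -(4 * M * A + 9 * M * A ^ 2) / t = -((4 * M * A + 9 * M * A ^ 2) / t) := by ring
  rw [e1, div_one] at k4
  rw [abs_le]
  constructor <;> linarith

theorem ContDiff.exists_quadratic_bound {g : ℝ → ℝ} (hg : ContDiff ℝ 2 g) :
    ∃ M, ∀ y ∈ Set.Icc (0 : ℝ) 1, |deriv g y| ≤ M ∧ ∀ x ∈ Set.Icc (0 : ℝ) 1,
      |g x - g y - deriv g y * (x - y)| ≤ M * (x - y) ^ 2 := by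
  have hd : ContDiff ℝ 1 (deriv g) := hg.deriv'
  obtain ⟨M₁, hM₁⟩ := isCompact_Icc.exists_bound_of_continuousOn
    (s := Set.Icc (0 : ℝ) 1) hd.continuous.continuousOn
  obtain ⟨M₂, hM₂⟩ := isCompact_Icc.exists_bound_of_continuousOn
    (s := Set.Icc (0 : ℝ) 1) (hd.continuous_deriv le_rfl).continuousOn
  refine ⟨max M₁ M₂, fun y hy => ⟨(hM₁ y hy).trans (le_max_left _ _), fun x hx => ?_⟩⟩
  have hM0 : 0 ≤ M₂ := (norm_nonneg _).trans (hM₂ y hy)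
  have hsub : Set.uIcc y x ⊆ Set.Icc 0 1 := Set.uIcc_subset_Icc hy hx
  have hlip : ∀ z ∈ Set.uIcc y x, ‖deriv g z - deriv g y‖ ≤ M₂ * |x - y| := by
    intro z hz
    refine (Convex.norm_image_sub_le_of_norm_deriv_le (f := deriv g)
      (fun w _ => (hd.differentiable one_ne_zero) w) (fun w hw => hM₂ w (hsub hw))
      (convex_uIcc y x) Set.left_mem_uIcc hz).trans ?_
    gcongr
    exact Set.abs_sub_left_of_mem_uIcc hz
  have hder : ∀ z, HasDerivAt (fun z => g z - deriv g y * z) (deriv g z - deriv g y) z := by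
    intro z
    simpa using ((hg.differentiable two_ne_zero) z).hasDerivAt.fun_sub
      ((hasDerivAt_id' z).const_mul (deriv g y))
  have := Convex.norm_image_sub_le_of_norm_hasDerivWithin_le
    (fun w _ => (hder w).hasDerivWithinAt) hlip (convex_uIcc y x)
    Set.left_mem_uIcc Set.right_mem_uIcc
  rw [Real.norm_eq_abs, Real.norm_eq_abs, mul_assoc, abs_mul_abs_self] at this
  calc |g x - g y - deriv g y * (x - y)| = |g x - deriv g y * x - (g y - deriv g y * y)| := by
        ring_nf
    _ ≤ M₂ * ((x - y) * (x - y)) := this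
    _ ≤ max M₁ M₂ * (x - y) ^ 2 := by rw [← sq]; gcongr; exact le_max_right _ _

/-- `(x, y)` solves the linear Landau–Zener system, written in components. -/
def IsLinSol (G : H →L[ℂ] H) (x y : ℝ → H) : Prop :=
  (∀ s : ℝ, HasDerivAt x (Complex.I • ((s : ℂ) • x s + G (y s))) s) ∧
    ∀ s : ℝ, HasDerivAt y (Complex.I • (ContinuousLinearMap.adjoint G (x s) - (s : ℂ) • y s)) s

theorem HasDerivAt.norm_sq_complex {E : Type*} [NormedAddCommGroup E]
    [InnerProductSpace ℂ E] {x : ℝ → E} {x' : E} {s : ℝ} (hx : HasDerivAt x x' s) :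
    HasDerivAt (fun s => ‖x s‖ ^ 2) (2 * (⟪x s, x'⟫_ℂ).re) s := by
  have h := Complex.reCLM.hasFDerivAt.comp_hasDerivAt s (hx.inner ℂ hx)
  refine (h.congr_deriv ?_).congr_of_eventuallyEq (Eventually.of_forall fun t => ?_)
  · simp only [map_add, reCLM_apply]
    rw [← inner_conj_symm x' (x s), conj_re]
    ring
  · simp only [Function.comp, reCLM_apply]
    exact (inner_self_eq_norm_sq (𝕜 := ℂ) (x t)).symm

namespace IsLinSol

variable {G : H →L[ℂ] H} {x y x' y' : ℝ → H}

theorem hasDerivAt_normSq_fst (h : IsLinSol G x y) (s : ℝ) :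
    HasDerivAt (fun s => ‖x s‖ ^ 2) (-2 * (⟪x s, G (y s)⟫_ℂ).im) s := by
  refine (h.1 s).norm_sq_complex.congr_deriv ?_
  have : (⟪x s, x s⟫_ℂ).im = 0 := inner_self_im (𝕜 := ℂ) (x s)
  simp [this, -inner_self_eq_norm_sq_to_K]

theorem hasDerivAt_normSq_snd (h : IsLinSol G x y) (s : ℝ) :
    HasDerivAt (fun s => ‖y s‖ ^ 2) (2 * (⟪x s, G (y s)⟫_ℂ).im) s := by
  refine (h.2 s).norm_sq_complex.congr_deriv ?_
  have : (⟪y s, y s⟫_ℂ).im = 0 := inner_self_im (𝕜 := ℂ) (y s)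
  have h2 : (⟪y s, ContinuousLinearMap.adjoint G (x s)⟫_ℂ).im = -(⟪x s, G (y s)⟫_ℂ).im := by
    rw [ContinuousLinearMap.adjoint_inner_right, ← inner_conj_symm, conj_im]
  simp [this, h2, -inner_self_eq_norm_sq_to_K]

theorem normSq_add_normSq (h : IsLinSol G x y) (s t : ℝ) :
    ‖x s‖ ^ 2 + ‖y s‖ ^ 2 = ‖x t‖ ^ 2 + ‖y t‖ ^ 2 := by
  have hd : ∀ s, HasDerivAt (fun s => ‖x s‖ ^ 2 + ‖y s‖ ^ 2) 0 s := fun s =>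
    ((h.hasDerivAt_normSq_fst s).fun_add (h.hasDerivAt_normSq_snd s)).congr_deriv (by ring)
  exact is_const_of_deriv_eq_zero (fun s => (hd s).differentiableAt) (fun s => (hd s).deriv) s t

theorem sub (h : IsLinSol G x y) (h' : IsLinSol G x' y') :
    IsLinSol G (fun s => x s - x' s) (fun s => y s - y' s) := by
  constructor <;> intro s
  · refine ((h.1 s).fun_sub (h'.1 s)).congr_deriv ?_
    simp only [map_sub]
    module
  · refine ((h.2 s).fun_sub (h'.2 s)).congr_deriv ?_
    simp only [map_sub]
    module

theorem const_smul (h : IsLinSol G x y) (c : ℂ) :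
    IsLinSol G (fun s => c • x s) (fun s => c • y s) := by
  constructor <;> intro s
  · refine ((h.1 s).fun_const_smul c).congr_deriv ?_
    simp only [map_smul]
    module
  · refine ((h.2 s).fun_const_smul c).congr_deriv ?_
    simp only [map_smul]
    module

theorem eq_of_tendsto_sub {l : Filter ℝ} [l.NeBot] (h : IsLinSol G x y) (h' : IsLinSol G x' y')
    (hx : Tendsto (fun s => x s - x' s) l (𝓝 0)) (hy : Tendsto (fun s => y s - y' s) l (𝓝 0)) :
    x = x' ∧ y = y' := by
  have hs := h.sub h'
  have key : ∀ s, ‖x s - x' s‖ ^ 2 + ‖y s - y' s‖ ^ 2 = 0 := by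
    intro s
    have h1 : Tendsto (fun t => ‖x t - x' t‖ ^ 2 + ‖y t - y' t‖ ^ 2) l (𝓝 0) := by
      simpa using (hx.norm.pow 2).add (hy.norm.pow 2)
    refine tendsto_nhds_unique (tendsto_const_nhds.congr fun t => ?_) h1
    exact hs.normSq_add_normSq s t
  constructor <;> funext s
  · have := (add_eq_zero_iff_of_nonneg (by positivity) (by positivity)).1 (key s)
    simpa [sub_eq_zero] using this.1
  · have := (add_eq_zero_iff_of_nonneg (by positivity) (by positivity)).1 (key s)
    simpa [sub_eq_zero] using this.2

theorem eq_of_eq_zero (h : IsLinSol G x y) (h' : IsLinSol G x' y')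
    (hx : x 0 = x' 0) (hy : y 0 = y' 0) : x = x' ∧ y = y' := by
  refine eq_of_tendsto_sub (l := pure 0) h h' ?_ ?_ <;>
  · refine tendsto_pure_left.2 fun s hs => ?_
    simpa [hx, hy] using mem_of_mem_nhds hs

theorem hasDerivAt_inner (h : IsLinSol G x y) (s : ℝ) :
    HasDerivAt (fun s => ⟪x s, G (y s)⟫_ℂ)
      (-(2 * s * Complex.I * ⟪x s, G (y s)⟫_ℂ) + Complex.I *
        ((‖ContinuousLinearMap.adjoint G (x s)‖ ^ 2 - ‖G (y s)‖ ^ 2 : ℝ) : ℂ)) s := by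
  have hGy : HasDerivAt (fun s => G (y s))
      (G (Complex.I • (ContinuousLinearMap.adjoint G (x s) - (s : ℂ) • y s))) s :=
    (G.restrictScalars ℝ).hasFDerivAt.comp_hasDerivAt s (h.2 s)
  refine ((h.1 s).inner ℂ hGy).congr_deriv ?_
  have h1 : ⟪x s, G (ContinuousLinearMap.adjoint G (x s))⟫_ℂ
      = (‖ContinuousLinearMap.adjoint G (x s)‖ : ℂ) ^ 2 := by
    rw [← ContinuousLinearMap.adjoint_inner_left, inner_self_eq_norm_sq_to_K]
    rfl
  have h2 : ⟪G (y s), G (y s)⟫_ℂ = (‖G (y s)‖ : ℂ) ^ 2 := inner_self_eq_norm_sq_to_K _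
  simp only [map_smul, map_sub, inner_smul_right, inner_smul_left, inner_add_left,
    inner_sub_right, h1, h2, conj_I, conj_ofReal]
  push_cast
  ring

theorem hasDerivAt_inner_re (h : IsLinSol G x y) (s : ℝ) :
    HasDerivAt (fun s => (⟪x s, G (y s)⟫_ℂ).re) (2 * s * (⟪x s, G (y s)⟫_ℂ).im) s := by
  refine (Complex.reCLM.hasFDerivAt.comp_hasDerivAt s (h.hasDerivAt_inner s)).congr_deriv ?_
  simp [-ofReal_pow]

theorem hasDerivAt_inner_im (h : IsLinSol G x y) (s : ℝ) :
    HasDerivAt (fun s => (⟪x s, G (y s)⟫_ℂ).im) (-2 * s * (⟪x s, G (y s)⟫_ℂ).re +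
      (‖ContinuousLinearMap.adjoint G (x s)‖ ^ 2 - ‖G (y s)‖ ^ 2)) s := by
  refine (Complex.imCLM.hasFDerivAt.comp_hasDerivAt s (h.hasDerivAt_inner s)).congr_deriv ?_
  simp [-ofReal_pow]

end IsLinSol

/-- Uniform bound for the phase shifts of normalised solutions of the linear system. -/
theorem exists_phase_shift_bound (G : H →L[ℂ] H) {g : ℝ → ℝ} (hg : ContDiff ℝ 2 g) :
    ∃ B, 0 ≤ B ∧ ∀ x y : ℝ → H, IsLinSol G x y → (∀ s, ‖x s‖ ^ 2 + ‖y s‖ ^ 2 = 1) → ∀ pinf : ℝ,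
      (Tendsto (fun s => ‖x s‖ ^ 2) atTop (𝓝 pinf) → ∀ t, 1 ≤ t →
        |∫ τ in (0 : ℝ)..t, (g (‖x τ‖ ^ 2) - g pinf)| ≤ B) ∧
      (Tendsto (fun s => ‖x s‖ ^ 2) atBot (𝓝 pinf) → ∀ t, t ≤ -1 →
        |∫ τ in t..(0 : ℝ), (g (‖x τ‖ ^ 2) - g pinf)| ≤ B) := by
  obtain ⟨M, hM⟩ := hg.exists_quadratic_bound
  have hM0 : 0 ≤ M := (abs_nonneg _).trans (hM 0 (by simp)).1
  set A : ℝ := ‖G‖ + ‖G‖ ^ 2 with hAdef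
  refine ⟨2 * M + 5 * M * A + 9 * M * A ^ 2, by positivity, fun x y h hn pinf => ?_⟩
  have hx1 : ∀ s, ‖x s‖ ≤ 1 := fun s =>
    (sq_le_one_iff₀ (norm_nonneg _)).1 (by linarith [hn s, sq_nonneg ‖y s‖])
  have hy1 : ∀ s, ‖y s‖ ≤ 1 := fun s =>
    (sq_le_one_iff₀ (norm_nonneg _)).1 (by linarith [hn s, sq_nonneg ‖x s‖])
  have hp01 : ∀ s, ‖x s‖ ^ 2 ∈ Set.Icc (0 : ℝ) 1 := fun s =>
    ⟨sq_nonneg _, by linarith [hn s, sq_nonneg ‖y s‖]⟩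
  have hGy : ∀ s, ‖G (y s)‖ ≤ ‖G‖ := fun s => G.unit_le_opNorm _ (hy1 s)
  have hGx : ∀ s, ‖ContinuousLinearMap.adjoint G (x s)‖ ≤ ‖G‖ := fun s =>
    ((ContinuousLinearMap.adjoint G).unit_le_opNorm _ (hx1 s)).trans_eq
      (LinearIsometryEquiv.norm_map _ _)
  have hq : ∀ s, ‖⟪x s, G (y s)⟫_ℂ‖ ≤ A := fun s => by
    have := (norm_inner_le_norm (𝕜 := ℂ) (x s) (G (y s))).trans
      (mul_le_mul (hx1 s) (hGy s) (norm_nonneg _) zero_le_one)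
    linarith [sq_nonneg ‖G‖]
  have ha : ∀ s, |(⟪x s, G (y s)⟫_ℂ).re| ≤ A := fun s => (abs_re_le_norm _).trans (hq s)
  have hb : ∀ s, |(⟪x s, G (y s)⟫_ℂ).im| ≤ A := fun s => (abs_im_le_norm _).trans (hq s)
  have hr : ∀ s, |‖ContinuousLinearMap.adjoint G (x s)‖ ^ 2 - ‖G (y s)‖ ^ 2| ≤ A := fun s => by
    have h1 := pow_le_pow_left₀ (norm_nonneg _) (hGy s) 2
    have h2 := pow_le_pow_left₀ (norm_nonneg _) (hGx s) 2
    rw [abs_le]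
    constructor <;> linarith [sq_nonneg ‖G (y s)‖, norm_nonneg G,
      sq_nonneg ‖ContinuousLinearMap.adjoint G (x s)‖]
  constructor
  · intro hlim t ht
    have hpinf := isClosed_Icc.mem_of_tendsto hlim (Eventually.of_forall hp01)
    exact abs_integral_comp_sub_limit_le h.hasDerivAt_normSq_fst h.hasDerivAt_inner_re
      h.hasDerivAt_inner_im ha hb hr hlim hp01 hg.continuous (hM pinf hpinf).1
      (hM pinf hpinf).2 ht
  · intro hlim t ht
    have hpinf := isClosed_Icc.mem_of_tendsto hlim (Eventually.of_forall hp01)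
    have hrefl : ∀ {φ : ℝ → ℝ} {φ' : ℝ → ℝ}, (∀ s, HasDerivAt φ (φ' s) s) →
        ∀ s, HasDerivAt (fun s => φ (-s)) (-(φ' (-s))) s := fun {φ φ'} hφ s => by
      have := (hφ (-s)).scomp s (hasDerivAt_neg' s)
      simpa [Function.comp_def] using this
    have key := abs_integral_comp_sub_limit_le (p := fun s => ‖x (-s)‖ ^ 2)
      (a := fun s => -(⟪x (-s), G (y (-s))⟫_ℂ).re) (b := fun s => -(⟪x (-s), G (y (-s))⟫_ℂ).im)
      (r := fun s => ‖ContinuousLinearMap.adjoint G (x (-s))‖ ^ 2 - ‖G (y (-s))‖ ^ 2)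
      (fun s => (hrefl h.hasDerivAt_normSq_fst s).congr_deriv (by ring))
      (fun s => (hrefl h.hasDerivAt_inner_re s).fun_neg.congr_deriv (by ring))
      (fun s => (hrefl h.hasDerivAt_inner_im s).fun_neg.congr_deriv (by ring))
      (fun s => (abs_neg _).trans_le (ha (-s))) (fun s => (abs_neg _).trans_le (hb (-s)))
      (fun s => hr (-s)) (hlim.comp tendsto_neg_atTop_atBot) (fun s => hp01 (-s)) hg.continuous
      (hM pinf hpinf).1 (hM pinf hpinf).2 (le_neg_of_le_neg ht)
    rw [intervalIntegral.integral_comp_neg (fun τ => g (‖x τ‖ ^ 2) - g pinf)] at key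
    simpa using key

theorem norm_fc_apply {A : H →L[ℂ] H} (hA : IsSelfAdjoint A) {χ : ℝ → ℂ} (hχ : Continuous χ)
    (h1 : ∀ t, ‖χ t‖ = 1) (v : H) : ‖fc χ A v‖ = ‖v‖ := by
  have hre : Continuous fun t => (χ t).re := continuous_re.comp hχ
  have him : Continuous fun t => (χ t).im := continuous_im.comp hχ
  set S := cfc (fun t => (χ t).re) A with hS
  set T := cfc (fun t => (χ t).im) A with hT
  have hSs : star S = S := (cfc_predicate (R := ℝ) (p := IsSelfAdjoint) (fun t => (χ t).re) A)
  have hTs : star T = T := (cfc_predicate (R := ℝ) (p := IsSelfAdjoint) (fun t => (χ t).im) A)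
  have hcomm : S * T = T * S := cfc_commute_cfc _ _ A
  have hsum : S * S + T * T = 1 := by
    rw [hS, hT, ← cfc_mul _ _ A hre.continuousOn hre.continuousOn,
      ← cfc_mul _ _ A him.continuousOn him.continuousOn,
      ← cfc_add A (fun t => (χ t).re * (χ t).re) (fun t => (χ t).im * (χ t).im)
        (hre.mul hre).continuousOn (him.mul him).continuousOn, ← cfc_one ℝ A]
    congr 1
    funext t
    have := Complex.sq_norm (χ t)
    rw [h1, normSq_apply] at this
    simpa using this.symm
  have hfc : fc χ A = S + Complex.I • T := rfl
  refine (ContinuousLinearMap.norm_map_iff_adjoint_comp_self (fc χ A)).2 ?_ v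
  change star (fc χ A) * fc χ A = 1
  rw [hfc, star_add, star_smul, hSs, hTs, ← hsum]
  simp only [add_mul, mul_add, smul_mul_assoc, mul_smul_comm, hcomm, star_def, conj_I]
  match_scalars <;> simp

theorem norm_ePhaseP_apply (G : H →L[ℂ] H) (s : ℝ) (v : H) : ‖ePhaseP G s v‖ = ‖v‖ := by
  refine norm_fc_apply (IsSelfAdjoint.mul_star_self G) ?_ (fun t => ?_) v
  · unfold phase; fun_prop
  · rw [mul_comm]; exact norm_exp_ofReal_mul_I _

theorem norm_ePhaseM_apply (G : H →L[ℂ] H) (s : ℝ) (v : H) : ‖ePhaseM G s v‖ = ‖v‖ := by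
  refine norm_fc_apply (IsSelfAdjoint.star_mul_self G) ?_ (fun t => ?_) v
  · unfold phase; fun_prop
  · rw [← mul_neg, ← ofReal_neg, mul_comm]
    exact norm_exp_ofReal_mul_I _

theorem tendsto_norm_of_asymptotics {E : Type*} [NormedAddCommGroup E]
    [InnerProductSpace ℂ E] {l : Filter ℝ} {U : ℝ → E →L[ℂ] E}
    (hU : ∀ s v, ‖U s v‖ = ‖v‖) {x : ℝ → E} {c : ℝ → ℂ} {a : E} (hc : ∀ s, ‖c s‖ = 1)
    (hx : Tendsto (fun s => ‖x s - c s • U s a‖) l (𝓝 0)) :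
    Tendsto (fun s => ‖x s‖) l (𝓝 ‖a‖) := by
  rw [tendsto_iff_norm_sub_tendsto_zero]
  refine squeeze_zero (fun s => norm_nonneg _) (fun s => ?_) hx
  have : ‖a‖ = ‖c s • U s a‖ := by rw [norm_smul, hc, hU, one_mul]
  rw [this]
  exact abs_norm_sub_norm_le _ _

theorem eq_smul_of_asymptotics {E : Type*} [NormedAddCommGroup E]
    [InnerProductSpace ℂ E] {l : Filter ℝ} [l.NeBot] {U : ℝ → E →L[ℂ] E}
    (hU : ∀ s v, ‖U s v‖ = ‖v‖) {x y : ℝ → E} {c d e : ℝ → ℂ} {a b : E} {κ : ℂ}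
    (hc : ∀ s, ‖c s‖ = 1) (he : ∀ s, ‖e s‖ = 1)
    (hx : Tendsto (fun s => ‖x s - c s • U s a‖) l (𝓝 0))
    (hy : Tendsto (fun s => ‖y s - d s • U s b‖) l (𝓝 0)) (hxy : ∀ s, x s = e s • y s)
    (hκ : Tendsto (fun s => e s * d s / c s) l (𝓝 κ)) : a = κ • b := by
  have h1 : Tendsto (fun s => ‖a - (e s * d s / c s) • b‖) l (𝓝 0) := by
    refine squeeze_zero (fun s => norm_nonneg _) (fun s => ?_) (by simpa using hx.add hy)
    have hc0 : c s ≠ 0 := fun h => by simpa [h] using hc s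
    calc ‖a - (e s * d s / c s) • b‖ = ‖c s • U s (a - (e s * d s / c s) • b)‖ := by
          rw [norm_smul, hc, hU, one_mul]
      _ = ‖e s • (y s - d s • U s b) - (x s - c s • U s a)‖ := by
          rw [hxy, map_sub, map_smul, smul_sub, smul_smul, mul_div_cancel₀ _ hc0]
          congr 1
          module
      _ ≤ ‖e s • (y s - d s • U s b)‖ + ‖x s - c s • U s a‖ := norm_sub_le _ _
      _ = ‖x s - c s • U s a‖ + ‖y s - d s • U s b‖ := by
          rw [norm_smul, he, one_mul, add_comm]
  have h2 : Tendsto (fun s => ‖a - (e s * d s / c s) • b‖) l (𝓝 ‖a - κ • b‖) :=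
    (tendsto_const_nhds.sub (hκ.smul_const b)).norm
  exact sub_eq_zero.1 (norm_eq_zero.1 (tendsto_nhds_unique h2 h1))

/-- `α` is the scattering state of `u` along the filter `l`, without phase shift and with equal
nonlinearities. -/
def ScatState (G : H →L[ℂ] H) (δ : ℝ) (f : ℝ × ℝ → ℝ) (l : Filter ℝ) (α : WithLp 2 (H × H))
    (u : ℝ → WithLp 2 (H × H)) : Prop :=
  Tendsto (fun s => ‖(u s).fst - asym1 G δ f α 0 s‖ + ‖(u s).snd - asym2 G δ f α 0 s‖) l (𝓝 0)

namespace ScatState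

variable {G : H →L[ℂ] H} {δ δ' : ℝ} {f : ℝ × ℝ → ℝ} {l : Filter ℝ} {α β : WithLp 2 (H × H)}
  {u v : ℝ → WithLp 2 (H × H)}

theorem fst (h : ScatState G δ f l α u) :
    Tendsto (fun s => ‖(u s).fst - Complex.exp (Complex.I * (δ * F1 f α * s : ℝ)) •
      ePhaseP G s α.fst‖) l (𝓝 0) := by
  refine squeeze_zero (fun s => norm_nonneg _) (fun s => ?_) h
  simp [asym1]

theorem snd (h : ScatState G δ f l α u) :
    Tendsto (fun s => ‖(u s).snd - Complex.exp (Complex.I * (δ * F1 f α * s : ℝ)) •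
      ePhaseM G s α.snd‖) l (𝓝 0) := by
  refine squeeze_zero (fun s => norm_nonneg _) (fun s => ?_) h
  simp [asym2, F1, F2]

theorem tendsto_norm_fst (h : ScatState G δ f l α u) :
    Tendsto (fun s => ‖(u s).fst‖) l (𝓝 ‖α.fst‖) :=
  tendsto_norm_of_asymptotics (norm_ePhaseP_apply G)
    (fun s => by rw [mul_comm]; exact norm_exp_ofReal_mul_I _) h.fst

theorem tendsto_norm_snd (h : ScatState G δ f l α u) :
    Tendsto (fun s => ‖(u s).snd‖) l (𝓝 ‖α.snd‖) :=
  tendsto_norm_of_asymptotics (norm_ePhaseM_apply G)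
    (fun s => by rw [mul_comm]; exact norm_exp_ofReal_mul_I _) h.snd

theorem norm_eq [l.NeBot] (h : ScatState G δ f l α u) (h' : ScatState G δ' f l β v)
    (hfst : ∀ s, ‖(u s).fst‖ = ‖(v s).fst‖) (hsnd : ∀ s, ‖(u s).snd‖ = ‖(v s).snd‖) :
    ‖α.fst‖ = ‖β.fst‖ ∧ ‖α.snd‖ = ‖β.snd‖ :=
  ⟨tendsto_nhds_unique (h.tendsto_norm_fst.congr hfst) h'.tendsto_norm_fst,
    tendsto_nhds_unique (h.tendsto_norm_snd.congr hsnd) h'.tendsto_norm_snd⟩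

theorem eq_smul [l.NeBot] (h : ScatState G δ f l α u) (h' : ScatState G 0 f l β v)
    {e : ℝ → ℂ} {κ : ℂ} (he : ∀ s, ‖e s‖ = 1) (huv : ∀ s, u s = e s • v s)
    (hκ : Tendsto (fun s => e s / Complex.exp (Complex.I * (δ * F1 f α * s : ℝ))) l (𝓝 κ)) :
    α = κ • β := by
  have hc : ∀ s : ℝ, ‖Complex.exp (Complex.I * (δ * F1 f α * s : ℝ))‖ = 1 := fun s => by
    rw [mul_comm]; exact norm_exp_ofReal_mul_I _
  have h1 := eq_smul_of_asymptotics (norm_ePhaseP_apply G) hc he h.fst h'.fst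
    (fun s => by rw [huv]; rfl) (by simpa using hκ)
  have h2 := eq_smul_of_asymptotics (norm_ePhaseM_apply G) hc he h.snd h'.snd
    (fun s => by rw [huv]; rfl) (by simpa using hκ)
  exact (WithLp.ofLp_injective 2) (Prod.ext h1 h2)

theorem isLinSol_eq_smul [l.NeBot] (h : ScatState G 0 f l α u) (h' : ScatState G 0 f l β v)
    (hu : IsLinSol G (fun s => (u s).fst) (fun s => (u s).snd))
    (hv : IsLinSol G (fun s => (v s).fst) (fun s => (v s).snd))
    {κ : ℂ} (hκ : α = κ • β) (s : ℝ) : u s = κ • v s := by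
  have h1 : α.fst = κ • β.fst := by rw [hκ]; rfl
  have h2 : α.snd = κ • β.snd := by rw [hκ]; rfl
  have aux : ∀ (x y : ℝ → H) (U : ℝ → H →L[ℂ] H) (a b : H), a = κ • b →
      Tendsto (fun s => ‖x s - U s a‖) l (𝓝 0) → Tendsto (fun s => ‖y s - U s b‖) l (𝓝 0) →
      Tendsto (fun s => x s - κ • y s) l (𝓝 0) := by
    intro x y U a b hab hx hy
    have := (tendsto_zero_iff_norm_tendsto_zero.2 hx).sub
      ((tendsto_zero_iff_norm_tendsto_zero.2 hy).const_smul κ)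
    simp only [hab, map_smul, smul_zero, sub_zero] at this
    exact this.congr fun s => by module
  have key := hu.eq_of_tendsto_sub (l := l) (hv.const_smul κ)
    (aux _ _ (ePhaseP G) _ _ h1 (by simpa using h.fst) (by simpa using h'.fst))
    (aux _ _ (ePhaseM G) _ _ h2 (by simpa using h.snd) (by simpa using h'.snd))
  exact (WithLp.ofLp_injective 2) (Prod.ext (congrFun key.1 s) (congrFun key.2 s))

end ScatState

namespace IsLZSol

variable {G : H →L[ℂ] H} {δ : ℝ} {f : ℝ × ℝ → ℝ} {u v : ℝ → WithLp 2 (H × H)}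

theorem hasDerivAt_fst (h : IsLZSol G δ f f u) (s : ℝ) :
    HasDerivAt (fun s => (u s).fst) (Complex.I • ((s : ℂ) • (u s).fst + G (u s).snd) +
      (Complex.I * (δ * F1 f (u s))) • (u s).fst) s := by
  have := ((WithLp.fstL 2 ℂ H H).restrictScalars ℝ).hasFDerivAt.comp_hasDerivAt s (h s)
  refine this.congr_deriv ?_
  change Complex.I • (((s : ℂ) • (u s).fst + G (u s).snd) + δ • (F1 f (u s)) • (u s).fst) = _
  rw [← Complex.coe_smul, ← Complex.coe_smul]
  module

theorem hasDerivAt_snd (h : IsLZSol G δ f f u) (s : ℝ) :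
    HasDerivAt (fun s => (u s).snd)
      (Complex.I • (ContinuousLinearMap.adjoint G (u s).fst - (s : ℂ) • (u s).snd) +
        (Complex.I * (δ * F1 f (u s))) • (u s).snd) s := by
  have := ((WithLp.sndL 2 ℂ H H).restrictScalars ℝ).hasFDerivAt.comp_hasDerivAt s (h s)
  refine this.congr_deriv ?_
  change Complex.I • ((ContinuousLinearMap.adjoint G (u s).fst - (s : ℂ) • (u s).snd) +
    δ • (F1 f (u s)) • (u s).snd) = _
  rw [← Complex.coe_smul, ← Complex.coe_smul]
  module

theorem isLinSol (h : IsLZSol G 0 f f u) :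
    IsLinSol G (fun s => (u s).fst) (fun s => (u s).snd) :=
  ⟨fun s => (h.hasDerivAt_fst s).congr_deriv (by simp),
    fun s => (h.hasDerivAt_snd s).congr_deriv (by simp)⟩

theorem continuous_F1 (h : IsLZSol G δ f f u) (hf : Continuous f) :
    Continuous fun s => F1 f (u s) := by
  have h1 : Continuous fun s => (u s).fst :=
    continuous_iff_continuousAt.2 fun s => (h.hasDerivAt_fst s).continuousAt
  have h2 : Continuous fun s => (u s).snd :=
    continuous_iff_continuousAt.2 fun s => (h.hasDerivAt_snd s).continuousAt
  exact hf.comp ((h1.norm.pow 2).prodMk (h2.norm.pow 2))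

theorem isLinSol_gauge (h : IsLZSol G δ f f u) (hf : Continuous f) :
    IsLinSol G
      (fun s => Complex.exp (-(Complex.I * (δ * ∫ τ in (0 : ℝ)..s, F1 f (u τ) : ℝ))) • (u s).fst)
      (fun s => Complex.exp (-(Complex.I * (δ * ∫ τ in (0 : ℝ)..s, F1 f (u τ) : ℝ))) •
        (u s).snd) := by
  have hc := h.continuous_F1 hf
  have he : ∀ s : ℝ, HasDerivAt
      (fun s : ℝ => Complex.exp (-(Complex.I * (δ * ∫ τ in (0 : ℝ)..s, F1 f (u τ) : ℝ))))
      (Complex.exp (-(Complex.I * (δ * ∫ τ in (0 : ℝ)..s, F1 f (u τ) : ℝ))) *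
        -(Complex.I * (δ * F1 f (u s) : ℝ))) s := fun s => by
    have h1 := intervalIntegral.integral_hasDerivAt_right (hc.intervalIntegrable 0 s)
      (hc.stronglyMeasurableAtFilter _ _) hc.continuousAt
    exact (((h1.const_mul δ).ofReal_comp).const_mul Complex.I).fun_neg.cexp
  constructor <;> intro s
  · refine ((he s).fun_smul (h.hasDerivAt_fst s)).congr_deriv ?_
    simp only [map_smul]
    push_cast
    module
  · refine ((he s).fun_smul (h.hasDerivAt_snd s)).congr_deriv ?_
    simp only [map_smul]
    push_cast
    module

/-- With equal nonlinearities, the nonlinear solution is a gauge transform of the linear one. -/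
theorem eq_gauge_smul (h : IsLZSol G δ f f u) (hv : IsLZSol G 0 f f v) (h0 : v 0 = u 0)
    (hf : Continuous f) (s : ℝ) :
    u s = Complex.exp (Complex.I * (δ * ∫ τ in (0 : ℝ)..s, F1 f (v τ) : ℝ)) • v s := by
  have key := (h.isLinSol_gauge hf).eq_of_eq_zero hv.isLinSol (by simp [h0]) (by simp [h0])
  have hn : ∀ r : ℝ, ‖Complex.exp (-(Complex.I * r))‖ = 1 := fun r => by
    rw [← mul_neg, ← ofReal_neg, mul_comm]
    exact norm_exp_ofReal_mul_I _
  have hF : ∀ τ, F1 f (u τ) = F1 f (v τ) := fun τ => by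
    have h1 := congrArg norm (congrFun key.1 τ)
    have h2 := congrArg norm (congrFun key.2 τ)
    rw [norm_smul, hn, one_mul] at h1 h2
    rw [F1, F1, h1, h2]
  have hv' : v s = Complex.exp (-(Complex.I * (δ * ∫ τ in (0 : ℝ)..s, F1 f (v τ) : ℝ))) • u s := by
    simp only [hF] at key
    exact (WithLp.ofLp_injective 2)
      (Prod.ext (congrFun key.1 s).symm (congrFun key.2 s).symm)
  conv_rhs => rw [hv', smul_smul, ← Complex.exp_add, add_neg_cancel, Complex.exp_zero, one_smul]

/-- The scattering states of the nonlinear solution and of the associated linear solution differ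
by the renormalised phase. -/
theorem scatState_eq (h : IsLZSol G δ f f u) (hv : IsLZSol G 0 f f v) (h0 : v 0 = u 0)
    (hf : Continuous f) {l : Filter ℝ} [l.NeBot] {α β : WithLp 2 (H × H)} {Λ : ℝ}
    (hα : ScatState G δ f l α u) (hβ : ScatState G 0 f l β v)
    (hΛ : Tendsto (fun t : ℝ => ∫ τ in (0 : ℝ)..t, (F1 f (v τ) - F1 f β)) l (𝓝 Λ)) :
    α = Complex.exp (Complex.I * (δ * Λ : ℝ)) • β := by
  have hn : ∀ r : ℝ, ‖Complex.exp (Complex.I * r)‖ = 1 := fun r => by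
    rw [mul_comm]
    exact norm_exp_ofReal_mul_I _
  have hu := h.eq_gauge_smul hv h0 hf
  have hF : F1 f α = F1 f β := by
    have := hα.norm_eq hβ
      (fun s => by rw [hu s, WithLp.smul_fst, norm_smul, hn, one_mul])
      (fun s => by rw [hu s, WithLp.smul_snd, norm_smul, hn, one_mul])
    rw [F1, F1, this.1, this.2]
  refine hα.eq_smul hβ (fun s => hn _) hu ?_
  have h1 : Tendsto
      (fun t : ℝ => Complex.exp (Complex.I *
        (δ * ∫ τ in (0 : ℝ)..t, (F1 f (v τ) - F1 f β) : ℝ))) l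
      (𝓝 (Complex.exp (Complex.I * (δ * Λ : ℝ)))) :=
    (((hΛ.const_mul δ).ofReal).const_mul Complex.I).cexp
  refine h1.congr fun t => ?_
  rw [← Complex.exp_sub, intervalIntegral.integral_sub
    ((hv.continuous_F1 hf).intervalIntegrable _ _) intervalIntegrable_const,
    intervalIntegral.integral_const, hF]
  congr 1
  push_cast [smul_eq_mul]
  ring

end IsLZSol

/-- second-order expansion of the scattering operator when `f₁ = f₂`
(last part of Theorem 1.12). -/
theorem stmt_6 {K : Type*} [NormedAddCommGroup K] [InnerProductSpace ℂ K]
    [FiniteDimensional ℂ K]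
    (G : K →L[ℂ] K) (hG : CommHyp G) (f₁ f₂ : ℝ × ℝ → ℝ)
    (hf₁ : C2Bdd f₁) (hf₂ : C2Bdd f₂) (hf : f₁ = f₂) (θ : ℝ → ℝ) (hθ : IsCutoff θ)
    (R : ℝ) (hR : 0 < R) :
    ∃ δ₀ > 0, ∃ C > 0, ∀ δ : ℝ, |δ| ≤ δ₀ →
      ∀ α : WithLp 2 (K × K), Theta G θ R α = α → ‖α.fst‖ ^ 2 + ‖α.snd‖ ^ 2 = 1 →
      ∀ u : ℝ → WithLp 2 (K × K), IsLZSol G δ f₁ f₂ u → Incoming G δ f₁ f₂ α 0 u →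
      ∀ ω : WithLp 2 (K × K), Outgoing G δ f₁ f₂ ω 0 u →
      ∀ ulin : ℝ → WithLp 2 (K × K), IsLZSol G 0 f₁ f₂ ulin → ulin 0 = u 0 →
      ∀ αlin ωlin : WithLp 2 (K × K),
        Incoming G 0 f₁ f₂ αlin 0 ulin → Outgoing G 0 f₁ f₂ ωlin 0 ulin →
      ∀ Λm Λp : ℝ,
        Tendsto (fun t : ℝ => ∫ τ in t..(0 : ℝ), (F1 f₁ (ulin τ) - F1 f₁ αlin))
          atBot (𝓝 Λm) →
        Tendsto (fun t : ℝ => ∫ τ in (0 : ℝ)..t, (F1 f₁ (ulin τ) - F1 f₁ ωlin))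
          atTop (𝓝 Λp) →
      ∀ w : ℝ → WithLp 2 (K × K), IsLZSol G 0 f₁ f₂ w → Incoming G 0 f₁ f₂ α 0 w →
      ∀ Slin : WithLp 2 (K × K), Outgoing G 0 f₁ f₂ Slin 0 w →
        |Λp| + |Λm| ≤ C ∧
        ‖ω - Slin - (Complex.I * (δ * (Λp + Λm))) • Slin‖ ≤ C * δ ^ 2 := by
  subst hf
  set g : ℝ → ℝ := fun p => f₁ (p, 1 - p) with hgdef
  have hfc : Continuous f₁ := hf₁.1.continuous
  have hg : ContDiff ℝ 2 g := hf₁.1.comp (contDiff_id.prodMk (contDiff_const.sub contDiff_id))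
  obtain ⟨B, hB0, hB⟩ := exists_phase_shift_bound G hg
  refine ⟨1 / (2 * B + 1), by positivity, 4 * B ^ 2 + 2 * B + 1, by positivity, ?_⟩
  intro δ hδ α _ hα1 u hu hin ω hout ulin hulin h0 αlin ωlin hinl houtl Λm Λp hΛm hΛp w hw hinw
    Slin houtw
  have hα : α = Complex.exp (Complex.I * (δ * -Λm : ℝ)) • αlin := by
    refine hu.scatState_eq hulin h0 hfc hin hinl ?_
    exact hΛm.neg.congr fun t => (intervalIntegral.integral_symm _ _).symm
  have hω : ω = Complex.exp (Complex.I * (δ * Λp : ℝ)) • ωlin :=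
    hu.scatState_eq hulin h0 hfc hout houtl hΛp
  have hn : ∀ r : ℝ, ‖Complex.exp (Complex.I * r)‖ = 1 := fun r => by
    rw [mul_comm]
    exact norm_exp_ofReal_mul_I _
  have hwu := ScatState.isLinSol_eq_smul (l := atBot) hinw hinl hw.isLinSol hulin.isLinSol hα
  have hS : Slin = Complex.exp (Complex.I * (δ * -Λm : ℝ)) • ωlin :=
    ScatState.eq_smul (l := atTop) houtw houtl (fun _ => hn _) hwu (by simp)
  have hαlin1 : ‖αlin.fst‖ ^ 2 + ‖αlin.snd‖ ^ 2 = 1 := by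
    rw [← hα1, hα, WithLp.smul_fst, WithLp.smul_snd, norm_smul, norm_smul, hn, one_mul, one_mul]
  have hlim : ∀ {l : Filter ℝ} {β : WithLp 2 (K × K)}, ScatState G 0 f₁ l β ulin →
      Tendsto (fun s => ‖(ulin s).fst‖ ^ 2 + ‖(ulin s).snd‖ ^ 2) l
        (𝓝 (‖β.fst‖ ^ 2 + ‖β.snd‖ ^ 2)) := fun h =>
    (h.tendsto_norm_fst.pow 2).add (h.tendsto_norm_snd.pow 2)
  have hulin1 : ∀ s, ‖(ulin s).fst‖ ^ 2 + ‖(ulin s).snd‖ ^ 2 = 1 := fun s => by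
    rw [← hαlin1]
    refine tendsto_nhds_unique (tendsto_const_nhds.congr fun t => ?_) (hlim (l := atBot) hinl)
    exact hulin.isLinSol.normSq_add_normSq s t
  have hωlin1 : ‖ωlin.fst‖ ^ 2 + ‖ωlin.snd‖ ^ 2 = 1 :=
    tendsto_nhds_unique (hlim (l := atTop) houtl) (tendsto_const_nhds.congr fun t => (hulin1 t).symm)
  have hF : ∀ v : WithLp 2 (K × K), ‖v.fst‖ ^ 2 + ‖v.snd‖ ^ 2 = 1 → F1 f₁ v = g (‖v.fst‖ ^ 2) :=
    fun v hv => by rw [F1, hgdef, eq_sub_of_add_eq' hv]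
  have hF' : ∀ τ, F1 f₁ (ulin τ) = g (‖(ulin τ).fst‖ ^ 2) := fun τ => hF _ (hulin1 τ)
  have hBp : |Λp| ≤ B := by
    refine le_of_tendsto hΛp.abs ?_
    filter_upwards [eventually_ge_atTop 1] with t ht
    simp only [hF', hF _ hωlin1]
    exact (hB _ _ hulin.isLinSol hulin1 _).1
      ((ScatState.tendsto_norm_fst (l := atTop) houtl).pow 2) t ht
  have hBm : |Λm| ≤ B := by
    refine le_of_tendsto hΛm.abs ?_
    filter_upwards [eventually_le_atBot (-1)] with t ht
    simp only [hF', hF _ hαlin1]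
    exact (hB _ _ hulin.isLinSol hulin1 _).2
      ((ScatState.tendsto_norm_fst (l := atBot) hinl).pow 2) t ht
  refine ⟨by nlinarith [sq_nonneg B], ?_⟩
  have hS1 : ‖Slin‖ = 1 := by
    rw [hS, norm_smul, hn, one_mul, ← sq_eq_sq₀ (norm_nonneg _) zero_le_one,
      WithLp.prod_norm_sq_eq_of_L2, hωlin1, one_pow]
  have hωS : ω = Complex.exp (Complex.I * (δ * (Λp + Λm))) • Slin := by
    rw [hω, hS, smul_smul, ← Complex.exp_add]
    congr 2
    push_cast
    ring
  have hsum : |Λp + Λm| ≤ 2 * B := (abs_add_le _ _).trans (by linarith)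
  have hz : ‖Complex.I * ((δ : ℂ) * (Λp + Λm))‖ = |δ| * |Λp + Λm| := by
    rw [norm_mul, norm_I, one_mul, norm_mul, ← ofReal_add, norm_real, norm_real]
    rfl
  have hz1 : |δ| * |Λp + Λm| ≤ 1 := by
    calc |δ| * |Λp + Λm| ≤ 1 / (2 * B + 1) * (2 * B + 1) := by
          gcongr; linarith
      _ = 1 := by field_simp
  calc ‖ω - Slin - (Complex.I * (δ * (Λp + Λm))) • Slin‖
      = ‖(Complex.exp (Complex.I * (δ * (Λp + Λm))) - 1 - Complex.I * (δ * (Λp + Λm))) • Slin‖ := by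
        rw [hωS]
        congr 1
        module
    _ ≤ (|δ| * |Λp + Λm|) ^ 2 := by
        rw [norm_smul, hS1, mul_one, ← hz]
        exact Complex.norm_exp_sub_one_sub_id_le (hz.trans_le hz1)
    _ = |Λp + Λm| ^ 2 * δ ^ 2 := by rw [mul_pow, sq_abs δ, mul_comm]
    _ ≤ (2 * B) ^ 2 * δ ^ 2 := by gcongr
    _ ≤ (4 * B ^ 2 + 2 * B + 1) * δ ^ 2 := by gcongr; linarith

end
end

section
/- Let R > 0 and let u₀ ∈ 𝓗² satisfy Θ_R u₀ = u₀ and ‖u₁(0)‖² + ‖u₂(0)‖² = 1, and let u be the solution of the nonlinear Landau–Zener system with datum u₀. Then there exist Ω₁, Ω₂, A₁, A₂ ∈ [0,1] and a constant C > 0 (depending only on R and the fixed data θ, δ, f₁, f₂, G) such that, for j = 1,2: (i) for all s ≥ 1, |‖uⱼ(s)‖² − Ωⱼ| ≤ C/s and the improper integral ∫_s^{+∞} (‖uⱼ(τ)‖² − Ωⱼ) dτ converges with |∫_s^{+∞} (‖uⱼ(τ)‖² − Ωⱼ) dτ| ≤ C/s; (ii) for all s ≤ −1, |‖uⱼ(s)‖²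 − Aⱼ| ≤ C/|s| and the improper integral ∫_{−∞}^s (‖uⱼ(τ)‖² − Aⱼ) dτ converges with |∫_{−∞}^s (‖uⱼ(τ)‖² − Aⱼ) dτ| ≤ C/|s|. -/
open ContinuousLinearMap Complex Filter Topology
open scoped InnerProductSpace

noncomputable section

variable {H : Type*} [NormedAddCommGroup H] [InnerProductSpace ℂ H] [CompleteSpace H]

/-- A function whose derivative is dominated by that of `c / s ^ n` converges at infinity,
at rate `c / s ^ n`. -/
theorem exists_tendsto_of_abs_deriv_le {f f' : ℝ → ℝ} {c s₀ : ℝ} {n : ℕ} (hn : n ≠ 0)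
    (hs₀ : 0 < s₀) (hf : ∀ s, s₀ ≤ s → HasDerivAt f (f' s) s)
    (hb : ∀ s, s₀ ≤ s → |f' s| ≤ n * c / s ^ (n + 1)) :
    ∃ L, Tendsto f atTop (𝓝 L) ∧ ∀ s, s₀ ≤ s → |f s - L| ≤ c / s ^ n := by
  have hφ : ∀ s, s₀ ≤ s → HasDerivAt (fun s : ℝ => c / s ^ n) (-(n * c / s ^ (n + 1))) s := by
    intro s hs
    have hs' : s ≠ 0 := (hs₀.trans_le hs).ne'
    refine ((hasDerivAt_const s c).fun_div (hasDerivAt_pow n s) (pow_ne_zero n hs')).congr_deriv ?_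
    obtain ⟨k, rfl⟩ := Nat.exists_eq_succ_of_ne_zero hn
    simp only [Nat.succ_eq_add_one, Nat.add_sub_cancel]
    field_simp
    ring
  have hφ0 : Tendsto (fun s : ℝ => c / s ^ n) atTop (𝓝 0) :=
    tendsto_const_nhds.div_atTop (tendsto_pow_atTop hn)
  have hmono : MonotoneOn (fun s => f s - c / s ^ n) (Set.Ici s₀) := by
    apply monotoneOn_of_hasDerivWithinAt_nonneg (f' := fun s => f' s - -(n * c / s ^ (n + 1)))
      (convex_Ici s₀)
    · intro s hs
      exact ((hf s hs).sub (hφ s hs)).continuousAt.continuousWithinAt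
    · intro s hs
      have hs := interior_subset hs
      exact ((hf s hs).sub (hφ s hs)).hasDerivWithinAt
    · intro s hs
      have := abs_le.1 (hb s (interior_subset hs))
      linarith
  have hanti : AntitoneOn (fun s => f s + c / s ^ n) (Set.Ici s₀) := by
    apply antitoneOn_of_hasDerivWithinAt_nonpos (f' := fun s => f' s + -(n * c / s ^ (n + 1)))
      (convex_Ici s₀)
    · intro s hs
      exact ((hf s hs).add (hφ s hs)).continuousAt.continuousWithinAt
    · intro s hs
      have hs := interior_subset hs
      exact ((hf s hs).add (hφ s hs)).hasDerivWithinAt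
    · intro s hs
      have := abs_le.1 (hb s (interior_subset hs))
      linarith
  have hc : 0 ≤ c := by
    have h1 := (abs_nonneg _).trans (hb s₀ le_rfl)
    have h2 : 0 < s₀ ^ (n + 1) := by positivity
    have h3 : (0 : ℝ) < n := by positivity
    by_contra! hlt
    exact absurd h1 (not_le.2 (div_neg_of_neg_of_pos (mul_neg_of_pos_of_neg h3 hlt) h2))
  have hmono' : Monotone (fun s => f (max s s₀) - c / (max s s₀) ^ n) := fun s t hst =>
    hmono (Set.mem_Ici.2 (le_max_right _ _)) (Set.mem_Ici.2 (le_max_right _ _))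
      (max_le_max_right _ hst)
  have hbdd : BddAbove (Set.range fun s => f (max s s₀) - c / (max s s₀) ^ n) := by
    refine ⟨f s₀ + c / s₀ ^ n, ?_⟩
    rintro _ ⟨s, rfl⟩
    have h1 := hanti (Set.self_mem_Ici) (le_max_right s s₀ : max s s₀ ∈ Set.Ici s₀)
      (le_max_right _ _)
    have h2 : 0 ≤ c / (max s s₀) ^ n := by
      have : 0 < max s s₀ := lt_max_of_lt_right hs₀
      positivity
    simp only at h1 ⊢
    linarith
  have hlim := tendsto_atTop_ciSup hmono' hbdd
  set L := ⨆ s, (f (max s s₀) - c / (max s s₀) ^ n) with hL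
  have hlim' : Tendsto (fun s => f s - c / s ^ n) atTop (𝓝 L) := by
    refine hlim.congr' ?_
    filter_upwards [eventually_ge_atTop s₀] with s hs
    rw [max_eq_left hs]
  have hfL : Tendsto f atTop (𝓝 L) := by simpa using hlim'.add hφ0
  have hfL' : Tendsto (fun s => f s + c / s ^ n) atTop (𝓝 L) := by simpa using hfL.add hφ0
  refine ⟨L, hfL, fun s hs => ?_⟩
  have h1 : f s - c / s ^ n ≤ L := by
    refine ge_of_tendsto hlim' ?_
    filter_upwards [eventually_ge_atTop s] with t ht
    exact hmono hs (hs.trans ht) ht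
  have h2 : L ≤ f s + c / s ^ n := by
    refine le_of_tendsto hfL' ?_
    filter_upwards [eventually_ge_atTop s] with t ht
    exact hanti hs (hs.trans ht) ht
  rw [abs_le]
  constructor <;> linarith

/-- The scalar system satisfied by `x = ‖u₁‖²`, `a = Re ⟪u₁, G u₂⟫`, `b = Im ⟪u₁, G u₂⟫`
along a solution of the Landau–Zener system of total mass one. -/
structure IsMassSystem (g x a b q : ℝ → ℝ) (M : ℝ) : Prop where
  hasDerivAt_x : ∀ s, HasDerivAt x (-2 * b s) s
  hasDerivAt_a : ∀ s, HasDerivAt a (2 * (s + g (x s)) * b s) s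
  hasDerivAt_b : ∀ s, HasDerivAt b (-2 * (s + g (x s)) * a s + q s) s
  abs_a_le : ∀ s, |a s| ≤ M
  abs_b_le : ∀ s, |b s| ≤ M
  abs_q_le : ∀ s, |q s| ≤ M
  x_mem : ∀ s, x s ∈ Set.Icc (0 : ℝ) 1

/-- Time reversal of the scalar mass system. -/
theorem IsMassSystem.reverse {g x a b q : ℝ → ℝ} {M : ℝ} (h : IsMassSystem g x a b q M) :
    IsMassSystem (fun y => -g y) (fun s => x (-s)) (fun s => -a (-s)) (fun s => -b (-s))
      (fun s => q (-s)) M where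
  hasDerivAt_x s := by
    refine ((h.hasDerivAt_x (-s)).scomp s (hasDerivAt_neg s)).congr_deriv ?_
    simp
  hasDerivAt_a s := by
    refine ((h.hasDerivAt_a (-s)).scomp s (hasDerivAt_neg s)).neg.congr_deriv ?_
    simp only [smul_eq_mul]
    ring
  hasDerivAt_b s := by
    refine ((h.hasDerivAt_b (-s)).scomp s (hasDerivAt_neg s)).neg.congr_deriv ?_
    simp only [smul_eq_mul]
    ring
  abs_a_le s := by simpa using h.abs_a_le (-s)
  abs_b_le s := by simpa using h.abs_b_le (-s)
  abs_q_le s := h.abs_q_le (-s)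
  x_mem s := h.x_mem (-s)

theorem abs_mul_le_mul {x y X Y : ℝ} (hx : |x| ≤ X) (hy : |y| ≤ Y) : |x * y| ≤ X * Y := by
  rw [abs_mul]
  exact mul_le_mul hx hy (abs_nonneg _) ((abs_nonneg _).trans hx)

/-- Convergence of the mass for large times, once the phase `s + g (x s)` is comparable
to `s`. -/
theorem IsMassSystem.exists_limit_of_large {g g' g'' x a b q : ℝ → ℝ} {M : ℝ} (hM : 1 ≤ M)
    (h : IsMassSystem g x a b q M) (hg : ∀ y, HasDerivAt g (g' y) y)
    (hg' : ∀ y, HasDerivAt g' (g'' y) y) (hgM : ∀ y ∈ Set.Icc (0 : ℝ) 1, |g y| ≤ M)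
    (hgM' : ∀ y ∈ Set.Icc (0 : ℝ) 1, |g' y| ≤ M)
    (hgM'' : ∀ y ∈ Set.Icc (0 : ℝ) 1, |g'' y| ≤ M) :
    ∃ Ω ∈ Set.Icc (0 : ℝ) 1, ∀ s, 2 * M ≤ s → |x s - Ω| ≤ 1000 * M ^ 5 / s ∧
      ∃ L, Tendsto (fun t => ∫ τ in s..t, (x τ - Ω)) atTop (𝓝 L) ∧
        |L| ≤ 1000 * M ^ 5 / s := by
  have hs₀ : 0 < 2 * M := by linarith
  set r : ℝ → ℝ := fun s => (s + g (x s))⁻¹ with hr_def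
  set d : ℝ → ℝ := fun s => 1 + g' (x s) * (-2 * b s) with hd_def
  set p : ℝ → ℝ := fun s => b s - g' (x s) * b s ^ 2 with hp_def
  have hσ : ∀ s, 2 * M ≤ s → s / 2 ≤ s + g (x s) := fun s hs => by
    have := (abs_le.1 (hgM _ (h.x_mem s))).1
    linarith
  have hσ0 : ∀ s, 2 * M ≤ s → s + g (x s) ≠ 0 := fun s hs => by
    have := hσ s hs
    intro h0
    linarith
  have hr : ∀ s, 2 * M ≤ s → |r s| ≤ 2 / s := fun s hs => by
    have h1 := hσ s hs
    have h2 : 0 < s := hs₀.trans_le hs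
    rw [hr_def, abs_of_nonneg (inv_nonneg.2 (by linarith))]
    rw [← inv_div s 2]
    exact inv_anti₀ (by linarith) h1
  have hdM : ∀ s, |d s| ≤ 3 * M ^ 2 := fun s => by
    have h1 := abs_mul_le_mul (hgM' _ (h.x_mem s)) (h.abs_b_le s)
    have h2 : d s = 1 - 2 * (g' (x s) * b s) := by simp only [hd_def]; ring
    rw [h2, abs_le]
    constructor <;> nlinarith [abs_le.1 h1]
  have hb2 : ∀ s, |b s ^ 2| ≤ M ^ 2 := fun s => by
    rw [abs_pow]
    exact pow_le_pow_left₀ (abs_nonneg _) (h.abs_b_le s) 2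
  have hpM : ∀ s, |p s| ≤ 2 * M ^ 3 := fun s => by
    have h1 := abs_mul_le_mul (hgM' _ (h.x_mem s)) (hb2 s)
    have h2 : M ≤ M ^ 3 := le_self_pow₀ hM (by norm_num)
    calc |p s| ≤ |b s| + |g' (x s) * b s ^ 2| := abs_sub _ _
      _ ≤ M + M * M ^ 2 := add_le_add (h.abs_b_le s) h1
      _ ≤ 2 * M ^ 3 := by linarith [show M * M ^ 2 = M ^ 3 by ring]
  have hσ' : ∀ s, HasDerivAt (fun s => s + g (x s)) (d s) s := fun s =>
    (hasDerivAt_id s).add ((hg _).comp s (h.hasDerivAt_x s))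
  have hr' : ∀ s, 2 * M ≤ s → HasDerivAt r (-d s * r s ^ 2) s := fun s hs => by
    refine ((hσ' s).fun_inv (hσ0 s hs)).congr_deriv ?_
    simp only [hr_def, inv_pow, div_eq_mul_inv]
  have hμ' : ∀ s, HasDerivAt (fun s => g' (x s)) (g'' (x s) * (-2 * b s)) s := fun s =>
    (hg' _).comp s (h.hasDerivAt_x s)
  have hy : ∀ s, 2 * M ≤ s → HasDerivAt (fun s => x s + a s * r s - p s * r s ^ 3 / 2)
      (-(q s * d s * r s ^ 3) / 2 + g'' (x s) * (-2 * b s) * b s ^ 2 * r s ^ 3 / 2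
        + 3 * p s * d s * r s ^ 4 / 2) s := fun s hs => by
    have hp : HasDerivAt p _ s := (h.hasDerivAt_b s).sub ((hμ' s).mul ((h.hasDerivAt_b s).pow 2))
    refine (((h.hasDerivAt_x s).add ((h.hasDerivAt_a s).mul (hr' s hs))).sub
      ((hp.mul ((hr' s hs).pow 3)).div_const 2)).congr_deriv ?_
    have h0 := hσ0 s hs
    have hrs : (s + g (x s)) * r s = 1 := mul_inv_cancel₀ h0
    generalize hρ : r s = ρ at hrs ⊢
    simp only [hp_def, hd_def, Pi.pow_apply, hρ]
    generalize s + g (x s) = σ at hrs ⊢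
    have hσρ : σ = ρ⁻¹ := eq_inv_of_mul_eq_one_left hrs
    have hρ0 : ρ ≠ 0 := right_ne_zero_of_mul_eq_one hrs
    subst hσρ
    field_simp
    push_cast
    ring
  have hr_pow : ∀ n : ℕ, ∀ s, 2 * M ≤ s → |r s ^ n| ≤ (2 / s) ^ n := fun n s hs => by
    rw [abs_pow]
    exact pow_le_pow_left₀ (abs_nonneg _) (hr s hs) n
  have hrM : ∀ s, 2 * M ≤ s → |r s| ≤ 1 := fun s hs =>
    (hr s hs).trans ((div_le_one (by linarith)).2 (by linarith))
  have hpow : ∀ {m n : ℕ}, m ≤ n → M ^ m ≤ M ^ n := fun hmn => pow_le_pow_right₀ hM hmn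
  have hyb : ∀ s, 2 * M ≤ s → |-(q s * d s * r s ^ 3) / 2
        + g'' (x s) * (-2 * b s) * b s ^ 2 * r s ^ 3 / 2
        + 3 * p s * d s * r s ^ 4 / 2| ≤ (2 : ℕ) * (60 * M ^ 5) / s ^ (2 + 1) := fun s hs => by
    have e1 : |q s * d s| ≤ M * (3 * M ^ 2) := abs_mul_le_mul (h.abs_q_le s) (hdM s)
    have e2 : |g'' (x s) * b s * b s ^ 2| ≤ M * M * M ^ 2 :=
      abs_mul_le_mul (abs_mul_le_mul (hgM'' _ (h.x_mem s)) (h.abs_b_le s)) (hb2 s)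
    have e3 : |p s * d s * r s| ≤ 2 * M ^ 3 * (3 * M ^ 2) * 1 :=
      abs_mul_le_mul (abs_mul_le_mul (hpM s) (hdM s)) (hrM s hs)
    have e4 : |(-(q s * d s) / 2 - g'' (x s) * b s * b s ^ 2 + 3 * (p s * d s * r s) / 2)|
        ≤ 15 * M ^ 5 := by
      have i1 : M ^ 3 ≤ M ^ 5 := hpow (by norm_num)
      have i2 : M ^ 4 ≤ M ^ 5 := hpow (by norm_num)
      have j1 : M * (3 * M ^ 2) = 3 * M ^ 3 := by ring
      have j2 : M * M * M ^ 2 = M ^ 4 := by ring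
      have j3 : 2 * M ^ 3 * (3 * M ^ 2) * 1 = 6 * M ^ 5 := by ring
      have j4 : 0 ≤ M ^ 5 := by positivity
      rw [j1] at e1
      rw [j2] at e2
      rw [j3] at e3
      rw [abs_le] at *
      constructor <;> linarith
    have e5 := abs_mul_le_mul e4 (hr_pow 3 s hs)
    have hs' : s ≠ 0 := by linarith
    calc _ = |(-(q s * d s) / 2 - g'' (x s) * b s * b s ^ 2 + 3 * (p s * d s * r s) / 2)
          * r s ^ 3| := by congr 1; ring
      _ ≤ _ := e5
      _ = _ := by push_cast; field_simp; norm_num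
  obtain ⟨Ω, -, hΩ⟩ := exists_tendsto_of_abs_deriv_le two_ne_zero hs₀ hy hyb
  have hxΩ : ∀ s, 2 * M ≤ s → |x s - Ω| ≤ 1000 * M ^ 5 / s := fun s hs => by
    have hs1 : 0 < s := hs₀.trans_le hs
    have e1 : |a s * r s| ≤ M * (2 / s) := abs_mul_le_mul (h.abs_a_le s) (hr s hs)
    have e2 : |p s * r s * r s ^ 2| ≤ 2 * M ^ 3 * (2 / s) * 1 :=
      abs_mul_le_mul (abs_mul_le_mul (hpM s) (hr s hs)) (by
        rw [abs_pow]
        exact pow_le_one₀ (abs_nonneg _) (hrM s hs))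
    have e3 : 60 * M ^ 5 / s ^ 2 ≤ 60 * M ^ 5 / s :=
      div_le_div_of_nonneg_left (by positivity) hs1 (le_self_pow₀ (by linarith) (by norm_num))
    have e4 := (hΩ s hs).trans e3
    have i1 : M / s ≤ M ^ 5 / s :=
      div_le_div_of_nonneg_right (le_self_pow₀ hM (by norm_num)) hs1.le
    have i2 : M ^ 3 / s ≤ M ^ 5 / s := div_le_div_of_nonneg_right (hpow (by norm_num)) hs1.le
    have j1 : M * (2 / s) = 2 * (M / s) := by ring
    have j2 : 2 * M ^ 3 * (2 / s) * 1 = 4 * (M ^ 3 / s) := by ring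
    have j3 : 60 * M ^ 5 / s = 60 * (M ^ 5 / s) := by ring
    have j4 : 1000 * M ^ 5 / s = 1000 * (M ^ 5 / s) := by ring
    have j5 : 0 ≤ M ^ 5 / s := by positivity
    have j6 : p s * r s * r s ^ 2 = p s * r s ^ 3 := by ring
    rw [j6, j2] at e2
    rw [j1] at e1
    rw [j3] at e4
    rw [j4]
    rw [abs_le] at *
    constructor <;> linarith
  have hxlim : Tendsto x atTop (𝓝 Ω) := by
    rw [tendsto_iff_norm_sub_tendsto_zero]
    refine squeeze_zero' (Eventually.of_forall fun _ => norm_nonneg _) ?_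
      (tendsto_const_nhds.div_atTop tendsto_id :
        Tendsto (fun s : ℝ => 1000 * M ^ 5 / s) atTop (𝓝 0))
    filter_upwards [eventually_ge_atTop (2 * M)] with s hs
    exact hxΩ s hs
  have hrlim : Tendsto r atTop (𝓝 0) := by
    rw [tendsto_zero_iff_norm_tendsto_zero]
    refine squeeze_zero' (Eventually.of_forall fun _ => norm_nonneg _) ?_
      (tendsto_const_nhds.div_atTop tendsto_id : Tendsto (fun s : ℝ => 2 / s) atTop (𝓝 0))
    filter_upwards [eventually_ge_atTop (2 * M)] with s hs
    exact hr s hs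
  have hblim : Tendsto (fun s => b s * r s ^ 2 / 2) atTop (𝓝 0) := by
    have h1 : Tendsto (fun s => r s ^ 2 * M) atTop (𝓝 0) := by
      simpa using (hrlim.pow 2).mul_const M
    rw [tendsto_zero_iff_norm_tendsto_zero]
    refine squeeze_zero (fun _ => norm_nonneg _) (fun s => ?_) h1
    have h2 := mul_le_mul_of_nonneg_left (h.abs_b_le s) (sq_nonneg (r s))
    have h3 : 0 ≤ r s ^ 2 * |b s| := by positivity
    rw [Real.norm_eq_abs, abs_div, abs_mul, abs_of_nonneg (sq_nonneg (r s)), abs_two]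
    linarith
  have hcont : Continuous fun s => x s - Ω := by
    refine Continuous.sub ?_ continuous_const
    exact continuous_iff_continuousAt.2 fun s => (h.hasDerivAt_x s).continuousAt
  refine ⟨Ω, isClosed_Icc.mem_of_tendsto hxlim (Eventually.of_forall h.x_mem),
    fun s hs => ⟨hxΩ s hs, ?_⟩⟩
  have hX : ∀ t, s ≤ t → HasDerivAt (fun t => (∫ τ in s..t, (x τ - Ω)) - b t * r t ^ 2 / 2)
      ((x t + a t * r t - p t * r t ^ 3 / 2 - Ω) + p t * r t ^ 3 / 2 - q t * r t ^ 2 / 2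
        + b t * d t * r t ^ 3) t := fun t ht => by
    have ht' := hs.trans ht
    refine ((hcont.integral_hasStrictDerivAt s t).hasDerivAt.sub
      (((h.hasDerivAt_b t).mul ((hr' t ht').pow 2)).div_const 2)).congr_deriv ?_
    have hrs : (t + g (x t)) * r t = 1 := mul_inv_cancel₀ (hσ0 t ht')
    simp only [Pi.pow_apply]
    push_cast
    linear_combination (a t * r t) * hrs
  have hXb : ∀ t, s ≤ t → |(x t + a t * r t - p t * r t ^ 3 / 2 - Ω) + p t * r t ^ 3 / 2
      - q t * r t ^ 2 / 2 + b t * d t * r t ^ 3|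
        ≤ (1 : ℕ) * (100 * M ^ 5) / t ^ (1 + 1) := fun t ht => by
    have ht' := hs.trans ht
    have ht0 : 0 < t := hs₀.trans_le ht'
    have e1 := hΩ t ht'
    have e2 : |p t * r t| ≤ 2 * M ^ 3 * 1 := abs_mul_le_mul (hpM t) (hrM t ht')
    have e3 : |b t * d t * r t| ≤ M * (3 * M ^ 2) * 1 :=
      abs_mul_le_mul (abs_mul_le_mul (h.abs_b_le t) (hdM t)) (hrM t ht')
    have e4 : |p t * r t / 2 - q t / 2 + b t * d t * r t| ≤ 10 * M ^ 5 := by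
      have e5 := h.abs_q_le t
      have i1 : M ^ 3 ≤ M ^ 5 := hpow (by norm_num)
      have i2 : M ≤ M ^ 5 := le_self_pow₀ hM (by norm_num)
      have j1 : M * (3 * M ^ 2) * 1 = 3 * M ^ 3 := by ring
      have j4 : 0 ≤ M ^ 5 := by positivity
      rw [j1] at e3
      rw [abs_le] at *
      constructor <;> linarith
    have e5 := abs_mul_le_mul e4 (hr_pow 2 t ht')
    calc _ = |(x t + a t * r t - p t * r t ^ 3 / 2 - Ω)
          + (p t * r t / 2 - q t / 2 + b t * d t * r t) * r t ^ 2| := by congr 1; ring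
      _ ≤ 60 * M ^ 5 / t ^ 2 + 10 * M ^ 5 * (2 / t) ^ 2 :=
        (abs_add_le _ _).trans (add_le_add e1 e5)
      _ = _ := by push_cast; field_simp; norm_num
  have hs1 : 0 < s := hs₀.trans_le hs
  obtain ⟨L, hL, hLb⟩ := exists_tendsto_of_abs_deriv_le one_ne_zero hs1 hX hXb
  refine ⟨L, by simpa using hL.add hblim, ?_⟩
  have e1 := hLb s le_rfl
  simp only [intervalIntegral.integral_same, pow_one, zero_sub] at e1
  have e2 : |b s * (r s * r s)| ≤ M * (1 * (2 / s)) :=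
    abs_mul_le_mul (h.abs_b_le s) (abs_mul_le_mul (hrM s hs) (hr s hs))
  have i1 : M / s ≤ M ^ 5 / s :=
    div_le_div_of_nonneg_right (le_self_pow₀ hM (by norm_num)) hs1.le
  have j1 : M * (1 * (2 / s)) = 2 * (M / s) := by ring
  have j2 : b s * (r s * r s) = b s * r s ^ 2 := by ring
  have j3 : 100 * M ^ 5 / s = 100 * (M ^ 5 / s) := by ring
  have j4 : 1000 * M ^ 5 / s = 1000 * (M ^ 5 / s) := by ring
  have j5 : 0 ≤ M ^ 5 / s := by positivity
  rw [j1, j2] at e2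
  rw [j3] at e1
  rw [j4]
  rw [abs_le] at *
  constructor <;> linarith

/-- Convergence of the mass with an integrable rate, uniformly over the solutions of the
scalar mass system. -/
theorem exists_const_isMassSystem_limit {g : ℝ → ℝ} (hg : ContDiff ℝ 2 g) (K : ℝ) :
    ∃ C > 0, ∀ x a b q : ℝ → ℝ, IsMassSystem g x a b q K →
      ∃ Ω ∈ Set.Icc (0 : ℝ) 1, ∀ s, 1 ≤ s → |x s - Ω| ≤ C / s ∧
        ∃ L, Tendsto (fun t => ∫ τ in s..t, (x τ - Ω)) atTop (𝓝 L) ∧ |L| ≤ C / s := by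
  have hg1 : ContDiff ℝ 1 (deriv g) :=
    ((contDiff_succ_iff_deriv (n := 1)).1 (by simpa [one_add_one_eq_two] using hg)).2.2
  have hg2 : Continuous (deriv (deriv g)) := hg1.continuous_deriv le_rfl
  obtain ⟨M₀, hM₀⟩ := (isCompact_Icc (a := (0 : ℝ)) (b := 1)).exists_bound_of_continuousOn
    hg.continuous.continuousOn
  obtain ⟨M₁, hM₁⟩ := (isCompact_Icc (a := (0 : ℝ)) (b := 1)).exists_bound_of_continuousOn
    hg1.continuous.continuousOn
  obtain ⟨M₂, hM₂⟩ := (isCompact_Icc (a := (0 : ℝ)) (b := 1)).exists_bound_of_continuousOn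
    hg2.continuousOn
  obtain ⟨M, hM1, hKM, hM₀M, hM₁M, hM₂M⟩ :
      ∃ M : ℝ, 1 ≤ M ∧ K ≤ M ∧ M₀ ≤ M ∧ M₁ ≤ M ∧ M₂ ≤ M :=
    ⟨max 1 (max K (max M₀ (max M₁ M₂))), by simp, by simp, by simp, by simp, by simp⟩
  refine ⟨1000 * M ^ 5 + (2 * M) ^ 2, by positivity, fun x a b q h => ?_⟩
  have h' : IsMassSystem g x a b q M :=
    { h with
      abs_a_le := fun s => (h.abs_a_le s).trans hKM
      abs_b_le := fun s => (h.abs_b_le s).trans hKM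
      abs_q_le := fun s => (h.abs_q_le s).trans hKM }
  obtain ⟨Ω, hΩ, hlarge⟩ := h'.exists_limit_of_large hM1
    (fun y => (hg.differentiable (by norm_num) y).hasDerivAt)
    (fun y => (hg1.differentiable (by norm_num) y).hasDerivAt)
    (fun y hy => (hM₀ y hy).trans hM₀M) (fun y hy => (hM₁ y hy).trans hM₁M)
    (fun y hy => (hM₂ y hy).trans hM₂M)
  have hx1 : ∀ s, |x s - Ω| ≤ 1 := fun s => by
    have := h.x_mem s
    rw [abs_le]
    constructor <;> linarith [this.1, this.2, hΩ.1, hΩ.2]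
  have hcont : Continuous fun s => x s - Ω := by
    refine Continuous.sub ?_ continuous_const
    exact continuous_iff_continuousAt.2 fun s => (h.hasDerivAt_x s).continuousAt
  refine ⟨Ω, hΩ, fun s hs => ?_⟩
  have hs0 : 0 < s := by linarith
  rcases le_total (2 * M) s with hMs | hMs
  · obtain ⟨e1, L, hL, e2⟩ := hlarge s hMs
    have e3 : 1000 * M ^ 5 / s ≤ (1000 * M ^ 5 + (2 * M) ^ 2) / s :=
      div_le_div_of_nonneg_right (by nlinarith) hs0.le
    exact ⟨e1.trans e3, L, hL, e2.trans e3⟩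
  · obtain ⟨-, L, hL, e2⟩ := hlarge (2 * M) le_rfl
    have e3 : 1000 * M ^ 5 / (2 * M) ≤ 1000 * M ^ 5 / s :=
      div_le_div_of_nonneg_left (by positivity) hs0 hMs
    have e4 : 2 * M ≤ (2 * M) ^ 2 / s := by
      rw [le_div_iff₀ hs0]
      nlinarith
    have e5 : 0 ≤ 1000 * M ^ 5 / s := by positivity
    rw [add_div]
    refine ⟨(hx1 s).trans (by linarith), (∫ τ in s..(2 * M), (x τ - Ω)) + L, ?_, ?_⟩
    · refine (hL.const_add _).congr fun t => ?_
      exact intervalIntegral.integral_add_adjacent_intervals (hcont.intervalIntegrable _ _)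
        (hcont.intervalIntegrable _ _)
    · have e6 : ‖∫ τ in s..(2 * M), (x τ - Ω)‖ ≤ 1 * |2 * M - s| :=
        intervalIntegral.norm_integral_le_of_norm_le_const fun τ _ => hx1 τ
      rw [Real.norm_eq_abs, abs_of_nonneg (by linarith : (0 : ℝ) ≤ 2 * M - s)] at e6
      have e7 := abs_add_le (∫ τ in s..(2 * M), (x τ - Ω)) L
      linarith

section LandauZener

variable {G : H →L[ℂ] H} {δ : ℝ} {f₁ f₂ : ℝ × ℝ → ℝ} {u : ℝ → WithLp 2 (H × H)}

theorem IsLZSol.hasDerivAt_fst_s7 (hu : IsLZSol G δ f₁ f₂ u) (s : ℝ) :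
    HasDerivAt (fun s => (u s).fst)
      (((s + δ * F1 f₁ (u s) : ℝ) * I) • (u s).fst + I • G (u s).snd) s := by
  refine (((WithLp.fstL 2 ℂ H H).restrictScalars ℝ).hasFDerivAt.comp_hasDerivAt s
    (hu s)).congr_deriv ?_
  change I • (((s : ℂ) • (u s).fst + G (u s).snd) + δ • F1 f₁ (u s) • (u s).fst) = _
  rw [smul_smul δ, ← Complex.coe_smul (δ * F1 f₁ (u s))]
  push_cast
  module

theorem IsLZSol.hasDerivAt_snd_s7 (hu : IsLZSol G δ f₁ f₂ u) (s : ℝ) :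
    HasDerivAt (fun s => (u s).snd)
      (((-s + δ * F2 f₂ (u s) : ℝ) * I) • (u s).snd + I • adjoint G (u s).fst) s := by
  refine (((WithLp.sndL 2 ℂ H H).restrictScalars ℝ).hasFDerivAt.comp_hasDerivAt s
    (hu s)).congr_deriv ?_
  change I • ((adjoint G (u s).fst - (s : ℂ) • (u s).snd) + δ • F2 f₂ (u s) • (u s).snd) = _
  rw [smul_smul δ, ← Complex.coe_smul (δ * F2 f₂ (u s))]
  push_cast
  module

theorem hasDerivAt_normSq {E : Type*} [NormedAddCommGroup E] [InnerProductSpace ℂ E]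
    {v : ℝ → E} {v' : E} {s : ℝ} (hv : HasDerivAt v v' s) :
    HasDerivAt (fun s => ‖v s‖ ^ 2) (2 * (⟪v s, v'⟫_ℂ).re) s := by
  have h := Complex.reCLM.hasFDerivAt.comp_hasDerivAt s (hv.inner ℂ hv)
  have h1 : (fun s => ‖v s‖ ^ 2) = Complex.reCLM ∘ fun s => ⟪v s, v s⟫_ℂ := by
    ext s
    exact (inner_self_eq_norm_sq (𝕜 := ℂ) (v s)).symm
  rw [h1]
  refine h.congr_deriv ?_
  have h2 : (⟪v', v s⟫_ℂ).re = (⟪v s, v'⟫_ℂ).re := inner_re_symm (𝕜 := ℂ) _ _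
  rw [Complex.reCLM_apply, Complex.add_re, h2, two_mul]

theorem IsLZSol.hasDerivAt_normSq_fst (hu : IsLZSol G δ f₁ f₂ u) (s : ℝ) :
    HasDerivAt (fun s => ‖(u s).fst‖ ^ 2) (-2 * (⟪(u s).fst, G (u s).snd⟫_ℂ).im) s := by
  refine (hasDerivAt_normSq (hu.hasDerivAt_fst_s7 s)).congr_deriv ?_
  rw [inner_add_right, inner_smul_right, inner_smul_right, inner_self_eq_norm_sq_to_K]
  simp [← Complex.ofReal_pow]

theorem IsLZSol.hasDerivAt_normSq_snd (hu : IsLZSol G δ f₁ f₂ u) (s : ℝ) :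
    HasDerivAt (fun s => ‖(u s).snd‖ ^ 2) (2 * (⟪(u s).fst, G (u s).snd⟫_ℂ).im) s := by
  refine (hasDerivAt_normSq (hu.hasDerivAt_snd_s7 s)).congr_deriv ?_
  rw [inner_add_right, inner_smul_right, inner_smul_right, inner_self_eq_norm_sq_to_K,
    adjoint_inner_right]
  have h : (⟪(u s).fst, G (u s).snd⟫_ℂ).im = -(⟪G (u s).snd, (u s).fst⟫_ℂ).im :=
    inner_im_symm (𝕜 := ℂ) _ _
  simp [← Complex.ofReal_pow, h]

/-- The total mass `‖u₁‖² + ‖u₂‖²` is conserved. -/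
theorem IsLZSol.mass_eq (hu : IsLZSol G δ f₁ f₂ u) (s : ℝ) :
    ‖(u s).fst‖ ^ 2 + ‖(u s).snd‖ ^ 2 = ‖(u 0).fst‖ ^ 2 + ‖(u 0).snd‖ ^ 2 := by
  have h : ∀ s, HasDerivAt (fun s => ‖(u s).fst‖ ^ 2 + ‖(u s).snd‖ ^ 2) 0 s := fun s =>
    ((hu.hasDerivAt_normSq_fst s).add (hu.hasDerivAt_normSq_snd s)).congr_deriv (by ring)
  exact is_const_of_deriv_eq_zero (fun s => (h s).differentiableAt) (fun s => (h s).deriv) s 0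

theorem IsLZSol.hasDerivAt_inner (hu : IsLZSol G δ f₁ f₂ u) (s : ℝ) :
    HasDerivAt (fun s => ⟪(u s).fst, G (u s).snd⟫_ℂ)
      (-(2 * (s + mscal δ f₁ f₂ (u s)) : ℝ) * I * ⟪(u s).fst, G (u s).snd⟫_ℂ
        + I * (‖adjoint G (u s).fst‖ ^ 2 - ‖G (u s).snd‖ ^ 2 : ℝ)) s := by
  refine ((hu.hasDerivAt_fst_s7 s).inner ℂ
    ((G.restrictScalars ℝ).hasFDerivAt.comp_hasDerivAt s (hu.hasDerivAt_snd_s7 s))).congr_deriv ?_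
  simp only [Function.comp_apply, coe_restrictScalars', map_add, map_smul, inner_add_right,
    inner_add_left, inner_smul_left, inner_smul_right, map_mul, Complex.conj_ofReal,
    Complex.conj_I, ← adjoint_inner_left G (adjoint G (u s).fst), inner_self_eq_norm_sq_to_K,
    mscal]
  push_cast
  simp only [Complex.coe_algebraMap]
  ring

/-- The masses of a Landau–Zener solution of total mass one solve the scalar system. -/
theorem IsLZSol.isMassSystem (hu : IsLZSol G δ f₁ f₂ u)
    (h0 : ‖(u 0).fst‖ ^ 2 + ‖(u 0).snd‖ ^ 2 = 1) :
    IsMassSystem (fun y => δ / 2 * (f₁ (y, 1 - y) - f₂ (y, 1 - y)))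
      (fun s => ‖(u s).fst‖ ^ 2) (fun s => (⟪(u s).fst, G (u s).snd⟫_ℂ).re)
      (fun s => (⟪(u s).fst, G (u s).snd⟫_ℂ).im)
      (fun s => ‖adjoint G (u s).fst‖ ^ 2 - ‖G (u s).snd‖ ^ 2) (‖G‖ + ‖G‖ ^ 2) := by
  have hmass : ∀ s, ‖(u s).fst‖ ^ 2 + ‖(u s).snd‖ ^ 2 = 1 := fun s => (hu.mass_eq s).trans h0
  have h1 : ∀ s, ‖(u s).fst‖ ≤ 1 := fun s => by nlinarith [hmass s, sq_nonneg ‖(u s).snd‖]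
  have h2 : ∀ s, ‖(u s).snd‖ ≤ 1 := fun s => by nlinarith [hmass s, sq_nonneg ‖(u s).fst‖]
  have hm : ∀ s, mscal δ f₁ f₂ (u s) = δ / 2 * (f₁ (‖(u s).fst‖ ^ 2, 1 - ‖(u s).fst‖ ^ 2)
      - f₂ (‖(u s).fst‖ ^ 2, 1 - ‖(u s).fst‖ ^ 2)) := fun s => by
    rw [← eq_sub_of_add_eq' (hmass s)]
    rfl
  have hG : ∀ s, ‖G (u s).snd‖ ≤ ‖G‖ := fun s => by
    simpa using G.le_opNorm_of_le (h2 s)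
  have hG' : ∀ s, ‖adjoint G (u s).fst‖ ≤ ‖G‖ := fun s => by
    simpa using (adjoint G).le_opNorm_of_le (h1 s)
  have hz : ∀ s, ‖⟪(u s).fst, G (u s).snd⟫_ℂ‖ ≤ ‖G‖ + ‖G‖ ^ 2 := fun s => by
    have h3 := (norm_inner_le_norm (𝕜 := ℂ) (u s).fst (G (u s).snd)).trans
      (mul_le_mul (h1 s) (hG s) (norm_nonneg _) zero_le_one)
    nlinarith [sq_nonneg ‖G‖]
  refine ⟨hu.hasDerivAt_normSq_fst, fun s => ?_, fun s => ?_,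
    fun s => (Complex.abs_re_le_norm _).trans (hz s),
    fun s => (Complex.abs_im_le_norm _).trans (hz s), fun s => ?_, fun s => ?_⟩
  · refine (Complex.reCLM.hasFDerivAt.comp_hasDerivAt s (hu.hasDerivAt_inner s)).congr_deriv ?_
    rw [← hm s, Complex.reCLM_apply, ← Complex.ofReal_neg]
    simp only [Complex.add_re, Complex.mul_re, Complex.mul_im, Complex.ofReal_re,
      Complex.ofReal_im, Complex.I_re, Complex.I_im]
    ring
  · refine (Complex.imCLM.hasFDerivAt.comp_hasDerivAt s (hu.hasDerivAt_inner s)).congr_deriv ?_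
    rw [← hm s, Complex.imCLM_apply, ← Complex.ofReal_neg]
    simp only [Complex.add_im, Complex.mul_re, Complex.mul_im, Complex.ofReal_re,
      Complex.ofReal_im, Complex.I_re, Complex.I_im]
    ring
  · have h3 := pow_le_pow_left₀ (norm_nonneg _) (hG s) 2
    have h4 := pow_le_pow_left₀ (norm_nonneg _) (hG' s) 2
    rw [abs_le]
    constructor <;>
      linarith [norm_nonneg G, sq_nonneg ‖G (u s).snd‖, sq_nonneg ‖adjoint G (u s).fst‖]
  · exact ⟨sq_nonneg _, by linarith [hmass s, sq_nonneg ‖(u s).snd‖]⟩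

end LandauZener

/-- convergence of the mass of each component, with integrable rate
(Proposition 3.2). -/
theorem stmt_7 {K : Type*} [NormedAddCommGroup K] [InnerProductSpace ℂ K]
    [FiniteDimensional ℂ K]
    (G : K →L[ℂ] K) (hG : CommHyp G) (hGu : IsUnit G) (δ : ℝ) (f₁ f₂ : ℝ × ℝ → ℝ)
    (hf₁ : C2Bdd f₁) (hf₂ : C2Bdd f₂) (θ : ℝ → ℝ) (hθ : IsCutoff θ)
    (R : ℝ) (hR : 0 < R) :
    ∃ C > 0, ∀ u₀ : WithLp 2 (K × K), ∀ u : ℝ → WithLp 2 (K × K),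
      Theta G θ R u₀ = u₀ → ‖u₀.fst‖ ^ 2 + ‖u₀.snd‖ ^ 2 = 1 →
      IsLZSol G δ f₁ f₂ u → u 0 = u₀ →
      ∃ Ω₁ Ω₂ A₁ A₂ : ℝ,
        Ω₁ ∈ Set.Icc (0 : ℝ) 1 ∧ Ω₂ ∈ Set.Icc (0 : ℝ) 1 ∧
        A₁ ∈ Set.Icc (0 : ℝ) 1 ∧ A₂ ∈ Set.Icc (0 : ℝ) 1 ∧
        (∀ s : ℝ, 1 ≤ s →
          |‖(u s).fst‖ ^ 2 - Ω₁| ≤ C / s ∧ |‖(u s).snd‖ ^ 2 - Ω₂| ≤ C / s ∧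
          (∃ L : ℝ, Tendsto (fun t : ℝ => ∫ τ in s..t, (‖(u τ).fst‖ ^ 2 - Ω₁))
              atTop (𝓝 L) ∧ |L| ≤ C / s) ∧
          (∃ L : ℝ, Tendsto (fun t : ℝ => ∫ τ in s..t, (‖(u τ).snd‖ ^ 2 - Ω₂))
              atTop (𝓝 L) ∧ |L| ≤ C / s)) ∧
        (∀ s : ℝ, s ≤ -1 →
          |‖(u s).fst‖ ^ 2 - A₁| ≤ C / |s| ∧ |‖(u s).snd‖ ^ 2 - A₂| ≤ C / |s| ∧
          (∃ L : ℝ, Tendsto (fun t : ℝ => ∫ τ in t..s, (‖(u τ).fst‖ ^ 2 - A₁))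
              atBot (𝓝 L) ∧ |L| ≤ C / |s|) ∧
          (∃ L : ℝ, Tendsto (fun t : ℝ => ∫ τ in t..s, (‖(u τ).snd‖ ^ 2 - A₂))
              atBot (𝓝 L) ∧ |L| ≤ C / |s|)) := by
  set g : ℝ → ℝ := fun y => δ / 2 * (f₁ (y, 1 - y) - f₂ (y, 1 - y)) with hg_def
  have hg : ContDiff ℝ 2 g := by
    have hl : ContDiff ℝ 2 fun y : ℝ => (y, 1 - y) := by fun_prop
    exact contDiff_const.mul ((hf₁.1.comp hl).sub (hf₂.1.comp hl))
  obtain ⟨C, hC, hplus⟩ := exists_const_isMassSystem_limit hg (‖G‖ + ‖G‖ ^ 2)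
  obtain ⟨C', hC', hminus⟩ := exists_const_isMassSystem_limit hg.neg (‖G‖ + ‖G‖ ^ 2)
  refine ⟨C + C', by positivity, fun u₀ u _ h1 hu hu0 => ?_⟩
  subst hu0
  have hsys := hu.isMassSystem h1
  obtain ⟨Ω, hΩ, hfut⟩ := hplus _ _ _ _ hsys
  obtain ⟨A, hA, hpast⟩ := hminus _ _ _ _ hsys.reverse
  have hsnd : ∀ s B, ‖(u s).snd‖ ^ 2 - (1 - B) = -(‖(u s).fst‖ ^ 2 - B) := fun s B => by
    linarith [hu.mass_eq s]
  refine ⟨Ω, 1 - Ω, A, 1 - A, hΩ, ⟨by linarith [hΩ.2], by linarith [hΩ.1]⟩, hA,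
    ⟨by linarith [hA.2], by linarith [hA.1]⟩, fun s hs => ?_, fun s hs => ?_⟩
  · obtain ⟨e1, L, hL, e2⟩ := hfut s hs
    have e3 : C / s ≤ (C + C') / s :=
      div_le_div_of_nonneg_right (by linarith) (by linarith)
    simp only [hsnd, intervalIntegral.integral_neg, abs_neg]
    exact ⟨e1.trans e3, e1.trans e3, ⟨L, hL, e2.trans e3⟩,
      ⟨-L, hL.neg, by simpa using e2.trans e3⟩⟩
  · have hs' : |s| = -s := abs_of_neg (by linarith)
    obtain ⟨e1, L, hL, e2⟩ := hpast (-s) (by linarith)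
    have e3 : C' / -s ≤ (C + C') / -s :=
      div_le_div_of_nonneg_right (by linarith) (by linarith)
    have hL' : Tendsto (fun t => ∫ τ in t..s, (‖(u τ).fst‖ ^ 2 - A)) atBot (𝓝 L) := by
      refine (hL.comp tendsto_neg_atBot_atTop).congr fun t => ?_
      simp [intervalIntegral.integral_comp_neg (fun τ => ‖(u τ).fst‖ ^ 2 - A)]
    simp only [hsnd, intervalIntegral.integral_neg, abs_neg, hs']
    rw [neg_neg] at e1
    exact ⟨e1.trans e3, e1.trans e3, ⟨L, hL', e2.trans e3⟩,
      ⟨-L, hL'.neg, by simpa using e2.trans e3⟩⟩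

end
end
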